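/- Let K be a number field. Suppose that ζ_K does not satisfy the Riemann hypothesis (i.e. Θ > 1/2) and that Θ' < Θ. Then for every ε with 0 < ε < Θ − Θ', one has M_K(x) = Ω_±(x^{Θ−ε}); that is, limsup_{x→∞} M_K(x)/x^{Θ−ε} > 0 and liminf_{x→∞} M_K(x)/x^{Θ−ε} < 0. In particular the naïve Mertens-type conjecture over K is false. -/

import Mathlib

noncomputable section

open NumberField Filter Topology MeasureTheory Complex

open scoped Classical

/-- The Möbius function on integral ideals of a number field `K`. -/
def moebiusK (K : Type) [Field K] [NumberField K] (I : Ideal (𝓞 K)) : ℤ :=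
  if Squarefree I then (-1) ^ (UniqueFactorizationMonoid.factors I).card else 0

/-- The Mertens function of a number field `K`: the sum of `μ_K(𝔞)` over nonzero integral
ideals `𝔞` of norm at most `x`, where ideals of norm exactly `x` count with weight `1/2`. -/
def mertensK (K : Type) [Field K] [NumberField K] (x : ℝ) : ℝ :=
  ∑' I : Ideal (𝓞 K),
    if I ≠ ⊥ ∧ (Ideal.absNorm I : ℝ) < x then (moebiusK K I : ℝ)
    else if I ≠ ⊥ ∧ (Ideal.absNorm I : ℝ) = x then (moebiusK K I : ℝ) / 2
    else 0

/-- `M_K^- = liminf_{x → ∞} M_K(x) / x^{1/2}`, as an extended real number. -/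
def MKminus (K : Type) [Field K] [NumberField K] : EReal :=
  Filter.liminf (fun x : ℝ => ((mertensK K x / Real.sqrt x : ℝ) : EReal)) Filter.atTop

/-- `M_K^+ = limsup_{x → ∞} M_K(x) / x^{1/2}`, as an extended real number. -/
def MKplus (K : Type) [Field K] [NumberField K] : EReal :=
  Filter.limsup (fun x : ℝ => ((mertensK K x / Real.sqrt x : ℝ) : EReal)) Filter.atTop

/-- The naïve Mertens-type conjecture over `K`: `-1 ≤ M_K^- ≤ M_K^+ ≤ 1`. -/
def NaiveMertensConj (K : Type) [Field K] [NumberField K] : Prop :=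
  -1 ≤ MKminus K ∧ MKminus K ≤ MKplus K ∧ MKplus K ≤ 1

/-- A predicate identifying the Dedekind zeta function of `K`: a function analytic away
from `s = 1` agreeing with the Dirichlet series `∑ N(𝔞)^{-s}` on `Re s > 1`. -/
def IsDedekindZeta (K : Type) [Field K] [NumberField K] (Z : ℂ → ℂ) : Prop :=
  (∀ s : ℂ, s ≠ 1 → DifferentiableAt ℂ Z s) ∧
  ∀ s : ℂ, 1 < s.re →
    Z s = ∑' I : {I : Ideal (𝓞 K) // I ≠ ⊥}, (Ideal.absNorm I.1 : ℂ) ^ (-s)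

/-- The Riemann hypothesis for a zeta function `Z`: all nontrivial zeros lie on `Re s = 1/2`. -/
def ZetaRH (Z : ℂ → ℂ) : Prop :=
  ∀ ρ : ℂ, Z ρ = 0 → 0 < ρ.re → ρ.re < 1 → ρ.re = 1 / 2

section ConeWeight

open NumberField.mixedEmbedding NumberField.InfinitePlace NumberField.Units
  NumberField.Units.dirichletUnitTheorem

/-- The tent function `max 0 (1 - |t|)`; its integer translates form a partition of unity. -/
def tent (t : ℝ) : ℝ := max 0 (1 - |t|)

lemma tent_nonneg (t : ℝ) : 0 ≤ tent t := le_max_left _ _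

lemma tent_le_one (t : ℝ) : tent t ≤ 1 :=
  max_le zero_le_one (by linarith [abs_nonneg t])

lemma abs_lt_one_of_tent_ne_zero {t : ℝ} (h : tent t ≠ 0) : |t| < 1 := by
  by_contra! h'
  exact h (max_eq_left (by linarith))

lemma abs_tent_sub_tent_le (a b : ℝ) : |tent a - tent b| ≤ |a - b| := by
  refine (abs_max_sub_max_le_max _ _ _ _).trans ?_
  simp only [sub_self, abs_zero, sub_sub_sub_cancel_left]
  refine max_le (abs_nonneg _) ?_
  rw [abs_sub_comm a b]
  exact abs_abs_sub_abs_le b a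

lemma abs_prod_sub_prod_le {ι : Type*} (s : Finset ι) (f g : ι → ℝ)
    (hf : ∀ i, 0 ≤ f i ∧ f i ≤ 1) (hg : ∀ i, 0 ≤ g i ∧ g i ≤ 1) :
    |∏ i ∈ s, f i - ∏ i ∈ s, g i| ≤ ∑ i ∈ s, |f i - g i| := by
  induction s using Finset.induction_on with
  | empty => simp
  | insert i s hi ih =>
    rw [Finset.prod_insert hi, Finset.prod_insert hi, Finset.sum_insert hi]
    have e : f i * ∏ i ∈ s, f i - g i * ∏ i ∈ s, g i =
        (f i - g i) * ∏ i ∈ s, f i + g i * (∏ i ∈ s, f i - ∏ i ∈ s, g i) := by ring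
    rw [e]
    refine (abs_add_le _ _).trans (add_le_add ?_ ?_)
    · rw [abs_mul]
      refine mul_le_of_le_one_right (abs_nonneg _) ?_
      rw [abs_of_nonneg (Finset.prod_nonneg fun i _ => (hf i).1)]
      exact Finset.prod_le_one (fun i _ => (hf i).1) (fun i _ => (hf i).2)
    · rw [abs_mul, abs_of_nonneg (hg i).1]
      exact (mul_le_of_le_one_left (abs_nonneg _) (hg i).2).trans ih

variable (K : Type) [Field K] [NumberField K]

/-- The basis of the logarithmic space given by a system of fundamental units. -/
def unitBasis : Module.Basis (Fin (rank K)) ℝ (logSpace K) :=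
  (basisUnitLattice K).ofZLatticeBasis ℝ (unitLattice K)

variable {K}

/-- A Lipschitz replacement for the indicator function of the fundamental cone. -/
def coneWeight (x : mixedSpace K) : ℝ :=
  ∏ i, tent ((unitBasis K).repr (logMap x) i)

/-- The weighted term `ψ(x) N(x)^{-s}`. -/
def weightedTerm (s : ℂ) (x : mixedSpace K) : ℂ :=
  coneWeight x * (mixedEmbedding.norm x : ℂ) ^ (-s)

lemma coneWeight_nonneg (x : mixedSpace K) : 0 ≤ coneWeight x :=
  Finset.prod_nonneg fun _ _ => tent_nonneg _

lemma coneWeight_le_one (x : mixedSpace K) : coneWeight x ≤ 1 :=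
  Finset.prod_le_one (fun _ _ => tent_nonneg _) (fun _ _ => tent_le_one _)

lemma exists_norm_logMap_le : ∃ A : ℝ, 0 < A ∧ ∀ x : mixedSpace K, coneWeight x ≠ 0 →
    ‖logMap x‖ ≤ A := by
  refine ⟨∑ i, ‖unitBasis K i‖ + 1, by positivity, fun x hx => ?_⟩
  have h : ∀ i, |(unitBasis K).repr (logMap x) i| < 1 := fun i =>
    abs_lt_one_of_tent_ne_zero (Finset.prod_ne_zero_iff.mp hx i (Finset.mem_univ i))
  rw [← (unitBasis K).sum_repr (logMap x)]
  refine (norm_sum_le _ _).trans ((Finset.sum_le_sum fun i _ => ?_).trans (by linarith :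
    ∑ i, ‖unitBasis K i‖ ≤ ∑ i, ‖unitBasis K i‖ + 1))
  rw [_root_.norm_smul]
  exact mul_le_of_le_one_left (norm_nonneg _) (h i).le

lemma normAtPlace_le_norm (w : InfinitePlace K) (x : mixedSpace K) : normAtPlace w x ≤ ‖x‖ := by
  rw [norm_eq_sup'_normAtPlace]
  exact Finset.le_sup' (fun w => normAtPlace w x) (Finset.mem_univ w)

lemma exists_norm_le_normAtPlace : ∃ a : ℝ, 0 < a ∧ a ≤ 1 ∧ ∀ x : mixedSpace K,
    coneWeight x ≠ 0 → mixedEmbedding.norm x ≠ 0 → ∀ w, a * ‖x‖ ≤ normAtPlace w x := by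
  obtain ⟨A, hA, h⟩ := exists_norm_logMap_le (K := K)
  set c : ℝ := (Fintype.card {w : InfinitePlace K // w ≠ w₀} : ℝ)
  have hc : 0 ≤ c := by positivity
  set B := (c + 1) * A
  have hB : 0 < B := by positivity
  refine ⟨Real.exp (-(2 * B)), Real.exp_pos _, Real.exp_le_one_iff.mpr (by linarith),
    fun x hx hn => ?_⟩
  set L := Real.log (mixedEmbedding.norm x) * (Module.finrank ℚ K : ℝ)⁻¹ with hL
  have hpos : ∀ w, 0 < normAtPlace w x := fun w =>
    lt_of_le_of_ne (normAtPlace_nonneg _ _) (mixedEmbedding.norm_ne_zero_iff.mp hn w).symm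
  have h1 : ∀ w : {w : InfinitePlace K // w ≠ w₀}, |logMap x w| ≤ A := fun w =>
    (norm_le_pi_norm (logMap x) w).trans (h x hx)
  have hsum : ∑ w : InfinitePlace K, (mult w : ℝ) * (Real.log (normAtPlace w x) - L) = 0 := by
    simp_rw [mul_sub]
    rw [Finset.sum_sub_distrib, ← Finset.sum_mul, ← Nat.cast_sum, sum_mult_eq, hL,
      mixedEmbedding.norm_apply, Real.log_prod (fun w _ => pow_ne_zero _ (hpos w).ne')]
    simp_rw [Real.log_pow]
    have : (Module.finrank ℚ K : ℝ) ≠ 0 := by exact_mod_cast Module.finrank_pos.ne'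
    field_simp
    ring
  have h2 : |(mult (w₀ : InfinitePlace K) : ℝ) * (Real.log (normAtPlace w₀ x) - L)| ≤ c * A := by
    rw [← Finset.add_sum_erase _ _ (Finset.mem_univ (w₀ : InfinitePlace K))] at hsum
    rw [eq_neg_of_add_eq_zero_left hsum, abs_neg,
      Finset.sum_subtype (F := inferInstance) (p := fun w => w ≠ w₀) _ (by simp)]
    refine (Finset.abs_sum_le_sum_abs _ _).trans ?_
    refine (Finset.sum_le_sum fun w _ => h1 w).trans ?_
    simp [c]
  have h3 : ∀ w, |Real.log (normAtPlace w x) - L| ≤ B := by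
    intro w
    have key : ∀ M, |(mult w : ℝ) * (Real.log (normAtPlace w x) - L)| ≤ M →
        |Real.log (normAtPlace w x) - L| ≤ M := by
      intro M hM
      rw [abs_mul, Nat.abs_cast] at hM
      exact (le_mul_of_one_le_left (abs_nonneg _) one_le_mult).trans hM
    by_cases hw : w = w₀
    · subst hw
      refine key _ (h2.trans ?_)
      simp only [B]; nlinarith
    · refine key _ ((h1 ⟨w, hw⟩).trans ?_)
      simp only [B]; nlinarith
  intro w
  have h4 : ‖x‖ ≤ Real.exp (L + B) := by
    rw [norm_eq_sup'_normAtPlace]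
    refine Finset.sup'_le _ _ fun v _ => ?_
    rw [← Real.log_le_iff_le_exp (hpos v)]
    linarith [(abs_le.mp (h3 v)).2]
  calc Real.exp (-(2 * B)) * ‖x‖ ≤ Real.exp (-(2 * B)) * Real.exp (L + B) := by gcongr
    _ = Real.exp (L - B) := by rw [← Real.exp_add]; ring_nf
    _ ≤ _ := by
      rw [← Real.le_log_iff_exp_le (hpos w)]
      linarith [(abs_le.mp (h3 w)).1]

lemma pow_le_mixedEmbedding_norm {x : mixedSpace K} {c : ℝ} (hc : 0 ≤ c)
    (h : ∀ w, c ≤ normAtPlace w x) : c ^ Module.finrank ℚ K ≤ mixedEmbedding.norm x := by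
  rw [mixedEmbedding.norm_apply, ← sum_mult_eq, ← Finset.prod_pow_eq_pow_sum]
  exact Finset.prod_le_prod (fun w _ => by positivity) fun w _ => pow_le_pow_left₀ hc (h w) _

lemma abs_log_sub_log_le {u v t : ℝ} (hu : 0 < u) (ht : t ≤ 1 / 2) (h : |v - u| ≤ t * u) :
    0 < v ∧ |Real.log v - Real.log u| ≤ 2 * t := by
  have hv := abs_le.mp h
  have hv0 : 0 < v := by nlinarith
  have ht0 : 0 ≤ t := by
    by_contra! ht'
    nlinarith [abs_nonneg (v - u)]
  refine ⟨hv0, ?_⟩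
  rw [← Real.log_div hv0.ne' hu.ne', abs_le]
  constructor
  · have h1 := Real.one_sub_inv_le_log_of_pos (div_pos hv0 hu)
    refine le_trans ?_ h1
    rw [inv_div]
    have : u / v ≤ 1 + 2 * t := by
      rw [div_le_iff₀ hv0]; nlinarith
    linarith
  · have h1 := Real.log_le_sub_one_of_pos (div_pos hv0 hu)
    refine h1.trans ?_
    have : v / u ≤ 1 + t := by
      rw [div_le_iff₀ hu]; nlinarith
    linarith

lemma abs_log_norm_sub_le {y z : mixedSpace K} {δ : ℝ}
    (hy : ∀ w, 0 < normAtPlace w y) (hz : ∀ w, 0 < normAtPlace w z)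
    (h : ∀ w, |Real.log (normAtPlace w z) - Real.log (normAtPlace w y)| ≤ δ) :
    |Real.log (mixedEmbedding.norm z) - Real.log (mixedEmbedding.norm y)| ≤
      Module.finrank ℚ K * δ := by
  rw [mixedEmbedding.norm_apply, mixedEmbedding.norm_apply,
    Real.log_prod (fun w _ => pow_ne_zero _ (hy w).ne'),
    Real.log_prod (fun w _ => pow_ne_zero _ (hz w).ne'), ← Finset.sum_sub_distrib,
    ← sum_mult_eq, Nat.cast_sum, Finset.sum_mul]
  refine (Finset.abs_sum_le_sum_abs _ _).trans (Finset.sum_le_sum fun w _ => ?_)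
  rw [Real.log_pow, Real.log_pow, ← mul_sub, abs_mul, Nat.abs_cast]
  gcongr
  exact h w

lemma norm_logMap_sub_le {y z : mixedSpace K} {δ : ℝ} (hδ : 0 ≤ δ)
    (hy : ∀ w, 0 < normAtPlace w y) (hz : ∀ w, 0 < normAtPlace w z)
    (h : ∀ w, |Real.log (normAtPlace w z) - Real.log (normAtPlace w y)| ≤ δ) :
    ‖logMap z - logMap y‖ ≤ 4 * δ := by
  rw [pi_norm_le_iff_of_nonneg (by positivity)]
  intro w
  have hN := abs_log_norm_sub_le hy hz h
  have hd : (0 : ℝ) < Module.finrank ℚ K := by exact_mod_cast Module.finrank_pos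
  rw [Pi.sub_apply, logMap_apply, logMap_apply, ← mul_sub, Real.norm_eq_abs, abs_mul, Nat.abs_cast]
  have h2 : (mult w.1 : ℝ) ≤ 2 := by
    have : mult w.1 ≤ 2 := by unfold mult; split_ifs <;> norm_num
    exact_mod_cast this
  have h3 : |(Real.log (mixedEmbedding.norm z) - Real.log (mixedEmbedding.norm y)) *
      (Module.finrank ℚ K : ℝ)⁻¹| ≤ δ := by
    rw [abs_mul, abs_inv, Nat.abs_cast, ← div_eq_mul_inv, div_le_iff₀ hd, mul_comm]
    exact hN
  have h4 : |Real.log (normAtPlace w.1 z) -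
      Real.log (mixedEmbedding.norm z) * (Module.finrank ℚ K : ℝ)⁻¹ -
      (Real.log (normAtPlace w.1 y) -
      Real.log (mixedEmbedding.norm y) * (Module.finrank ℚ K : ℝ)⁻¹)| ≤ 2 * δ := by
    have e : Real.log (normAtPlace w.1 z) -
      Real.log (mixedEmbedding.norm z) * (Module.finrank ℚ K : ℝ)⁻¹ -
      (Real.log (normAtPlace w.1 y) -
      Real.log (mixedEmbedding.norm y) * (Module.finrank ℚ K : ℝ)⁻¹) =
      (Real.log (normAtPlace w.1 z) - Real.log (normAtPlace w.1 y)) -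
      (Real.log (mixedEmbedding.norm z) - Real.log (mixedEmbedding.norm y)) *
      (Module.finrank ℚ K : ℝ)⁻¹ := by ring
    rw [e]
    exact (abs_sub _ _).trans (by linarith [h w.1])
  calc _ ≤ 2 * (2 * δ) := by gcongr
    _ = 4 * δ := by ring

lemma exists_abs_coneWeight_sub_le : ∃ C : ℝ, 0 < C ∧ ∀ y z : mixedSpace K,
    |coneWeight z - coneWeight y| ≤ C * ‖logMap z - logMap y‖ := by
  have h : ∀ i, ∃ c : ℝ, 0 < c ∧ ∀ v : logSpace K, |(unitBasis K).repr v i| ≤ c * ‖v‖ := by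
    intro i
    obtain ⟨c, hc, h⟩ :=
      (LinearMap.toContinuousLinearMap ((unitBasis K).coord i)).isBoundedLinearMap.bound
    exact ⟨c, hc, h⟩
  choose c hc h using h
  refine ⟨∑ i, c i + 1, add_pos_of_nonneg_of_pos (Finset.sum_nonneg fun i _ => (hc i).le) one_pos,
    fun y z => ?_⟩
  refine (abs_prod_sub_prod_le _ _ _ (fun i => ⟨tent_nonneg _, tent_le_one _⟩)
    (fun i => ⟨tent_nonneg _, tent_le_one _⟩)).trans ?_
  rw [add_mul, Finset.sum_mul]
  refine (Finset.sum_le_sum fun i _ => ?_).trans (le_add_of_nonneg_right (by positivity))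
  refine (abs_tent_sub_tent_le _ _).trans ?_
  have := h i (logMap z - logMap y)
  rwa [map_sub, Finsupp.sub_apply] at this

end ConeWeight

section WeightedTerm

open NumberField.mixedEmbedding NumberField.InfinitePlace NumberField.Units
  NumberField.Units.dirichletUnitTheorem

variable {K : Type} [Field K] [NumberField K]

lemma weightedTerm_eq_zero_of_norm {s : ℂ} (hs : 0 < s.re) {y : mixedSpace K}
    (hy : mixedEmbedding.norm y = 0) : weightedTerm s y = 0 := by
  have : -s ≠ 0 := by
    rw [neg_ne_zero]; rintro rfl; simp at hs
  rw [weightedTerm, hy, Complex.ofReal_zero, Complex.zero_cpow this, mul_zero]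

lemma norm_weightedTerm_le_rpow {s : ℂ} {y : mixedSpace K} (hy : 0 < mixedEmbedding.norm y) :
    ‖weightedTerm s y‖ ≤ mixedEmbedding.norm y ^ (-s.re) := by
  rw [weightedTerm, norm_mul, Complex.norm_real, Real.norm_eq_abs, abs_of_nonneg
    (coneWeight_nonneg y), Complex.norm_cpow_eq_rpow_re_of_pos hy, Complex.neg_re]
  exact mul_le_of_le_one_left (by positivity) (coneWeight_le_one y)

lemma norm_weightedTerm_le_one {s : ℂ} (hs : 0 < s.re) {y : mixedSpace K}
    (hy : mixedEmbedding.norm y = 0 ∨ 1 ≤ mixedEmbedding.norm y) : ‖weightedTerm s y‖ ≤ 1 := by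
  rcases hy with hy | hy
  · rw [weightedTerm_eq_zero_of_norm hs hy, norm_zero]; exact zero_le_one
  · exact (norm_weightedTerm_le_rpow (by linarith)).trans
      (Real.rpow_le_one_of_one_le_of_nonpos hy (by linarith))

lemma norm_pos_of_mixedEmbedding_norm_ne_zero {y : mixedSpace K}
    (hy : mixedEmbedding.norm y ≠ 0) : 0 < ‖y‖ := by
  rw [norm_pos_iff]
  rintro rfl
  exact hy (map_zero _)

lemma exists_rpow_norm_le (K : Type) [Field K] [NumberField K] :
    ∃ a : ℝ, 0 < a ∧ a ≤ 1 ∧ ∀ y : mixedSpace K, coneWeight y ≠ 0 →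
      mixedEmbedding.norm y ≠ 0 → (∀ w, a * ‖y‖ ≤ normAtPlace w y) ∧ ∀ σ : ℝ, 0 ≤ σ →
        mixedEmbedding.norm y ^ (-σ) ≤
          a ^ (-(Module.finrank ℚ K * σ)) * ‖y‖ ^ (-(Module.finrank ℚ K * σ)) := by
  obtain ⟨a, ha, ha1, h⟩ := exists_norm_le_normAtPlace (K := K)
  refine ⟨a, ha, ha1, fun y hy hn => ⟨h y hy hn, fun σ hσ => ?_⟩⟩
  have hy0 := norm_pos_of_mixedEmbedding_norm_ne_zero hn
  have h1 := pow_le_mixedEmbedding_norm (by positivity) (h y hy hn)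
  calc mixedEmbedding.norm y ^ (-σ) ≤ ((a * ‖y‖) ^ Module.finrank ℚ K) ^ (-σ) :=
        Real.rpow_le_rpow_of_nonpos (by positivity) h1 (by linarith)
    _ = (a * ‖y‖) ^ (-(Module.finrank ℚ K * σ)) := by
        rw [← Real.rpow_natCast, ← Real.rpow_mul (by positivity), mul_neg]
    _ = _ := Real.mul_rpow ha.le (norm_nonneg _)

lemma exists_norm_weightedTerm_le (K : Type) [Field K] [NumberField K] (s : ℂ) (hs : 0 < s.re) :
    ∃ C : ℝ, ∀ y : mixedSpace K,
      ‖weightedTerm s y‖ ≤ C * ‖y‖ ^ (-(Module.finrank ℚ K * s.re)) := by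
  obtain ⟨a, ha, ha1, h⟩ := exists_rpow_norm_le K
  refine ⟨a ^ (-(Module.finrank ℚ K * s.re)), fun y => ?_⟩
  by_cases hn : mixedEmbedding.norm y = 0
  · rw [weightedTerm_eq_zero_of_norm hs hn, norm_zero]; positivity
  by_cases hy : coneWeight y = 0
  · rw [weightedTerm, hy, ofReal_zero, zero_mul, norm_zero]; positivity
  · exact (norm_weightedTerm_le_rpow (lt_of_le_of_ne (mixedEmbedding.norm_nonneg _)
      (Ne.symm hn))).trans ((h y hy hn).2 _ hs.le)

lemma abs_normAtPlace_sub_le (w : InfinitePlace K) (y z : mixedSpace K) :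
    |normAtPlace w z - normAtPlace w y| ≤ ‖z - y‖ := by
  have h1 := normAtPlace_add_le w (z - y) y
  have h2 := normAtPlace_add_le w (y - z) z
  have h3 := normAtPlace_le_norm w (z - y)
  have h4 := normAtPlace_le_norm w (y - z)
  rw [norm_sub_rev y z] at h4
  rw [sub_add_cancel] at h1 h2
  rw [abs_le]; constructor <;> linarith

lemma norm_one_sub_exp_le (w : ℂ) : ‖1 - Complex.exp w‖ ≤ ‖w‖ * Real.exp ‖w‖ := by
  have := Complex.norm_exp_sub_sum_le_norm_mul_exp w 1
  simpa [norm_sub_rev] using this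

lemma norm_cpow_neg_sub_le {u v : ℝ} (hu : 0 < u) (hv : 0 < v) {s : ℂ} (hs : ‖s‖ ≤ 2) :
    ‖(u : ℂ) ^ (-s) - (v : ℂ) ^ (-s)‖ ≤ u ^ (-s.re) *
      (2 * |Real.log v - Real.log u| * Real.exp (2 * |Real.log v - Real.log u|)) := by
  have e : (v : ℂ) ^ (-s) = (u : ℂ) ^ (-s) *
      Complex.exp (-s * ((Real.log v - Real.log u : ℝ) : ℂ)) := by
    rw [Complex.cpow_def_of_ne_zero (by exact_mod_cast hv.ne'),
      Complex.cpow_def_of_ne_zero (by exact_mod_cast hu.ne'), ← Complex.exp_add,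
      ← Complex.ofReal_log hu.le, ← Complex.ofReal_log hv.le]
    congr 1
    push_cast
    ring
  have hb : ‖-s * ((Real.log v - Real.log u : ℝ) : ℂ)‖ ≤ 2 * |Real.log v - Real.log u| := by
    rw [norm_mul, norm_neg, Complex.norm_real, Real.norm_eq_abs]
    gcongr
  rw [e, ← mul_one_sub, norm_mul, Complex.norm_cpow_eq_rpow_re_of_pos hu, Complex.neg_re]
  gcongr
  refine (norm_one_sub_exp_le _).trans ?_
  gcongr

lemma exists_norm_weightedTerm_sub_le_of_ne_zero (K : Type) [Field K] [NumberField K]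
    {B σ : ℝ} (hB : 0 < B) (hσ : 0 < σ) :
    ∃ C : ℝ, 0 ≤ C ∧ ∀ s : ℂ, σ ≤ s.re → ‖s‖ ≤ 2 → ∀ y z : mixedSpace K,
      (mixedEmbedding.norm y = 0 ∨ 1 ≤ mixedEmbedding.norm y) →
      (mixedEmbedding.norm z = 0 ∨ 1 ≤ mixedEmbedding.norm z) →
      ‖z - y‖ ≤ B → weightedTerm s y ≠ 0 →
      ‖weightedTerm s y - weightedTerm s z‖ ≤ C * ‖y‖ ^ (-(Module.finrank ℚ K * σ + 1)) := by
  obtain ⟨a, ha, ha1, h⟩ := exists_rpow_norm_le K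
  obtain ⟨C₁, hC₁, h₁⟩ := exists_abs_coneWeight_sub_le (K := K)
  set d : ℝ := (Module.finrank ℚ K : ℝ) with hd
  have hd1 : 1 ≤ d := Nat.one_le_cast.mpr (Module.finrank_pos (R := ℚ) (M := K))
  set R : ℝ := 1 + 2 * B / a with hR
  have hR1 : 1 ≤ R := by
    have : 0 ≤ 2 * B / a := by positivity
    linarith
  set C₂ : ℝ := C₁ * (4 * (2 * (B / a))) + 2 * (d * (2 * (B / a))) * Real.exp (2 * d)
  have hC₂ : 0 ≤ C₂ := by positivity
  refine ⟨2 * R ^ (d * σ + 1) + a ^ (-(d * 2)) * C₂, by positivity, fun s hs hs2 y z hy hz hyz hne => ?_⟩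
  have hs0 : 0 < s.re := hσ.trans_le hs
  have hyn : mixedEmbedding.norm y ≠ 0 := fun h0 => hne (weightedTerm_eq_zero_of_norm hs0 h0)
  have hyw : coneWeight y ≠ 0 := by
    intro h0
    exact hne (by rw [weightedTerm, h0, ofReal_zero, zero_mul])
  have hy0 := norm_pos_of_mixedEmbedding_norm_ne_zero hyn
  have hyN : 0 < mixedEmbedding.norm y :=
    lt_of_le_of_ne (mixedEmbedding.norm_nonneg _) (Ne.symm hyn)
  rw [add_mul]
  rcases le_or_gt ‖y‖ R with hyR | hyR
  · have h1 : 1 ≤ R ^ (d * σ + 1) * ‖y‖ ^ (-(d * σ + 1)) := by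
      rw [Real.rpow_neg hy0.le, ← div_eq_mul_inv, one_le_div (by positivity)]
      exact Real.rpow_le_rpow hy0.le hyR (by positivity)
    have h2 : ‖weightedTerm s y - weightedTerm s z‖ ≤ 2 :=
      (norm_sub_le _ _).trans (by
        linarith [norm_weightedTerm_le_one hs0 hy, norm_weightedTerm_le_one hs0 hz])
    have h3 : 0 ≤ a ^ (-(d * 2)) * C₂ * ‖y‖ ^ (-(d * σ + 1)) := by positivity
    linarith
  · have hy1 : 1 ≤ ‖y‖ := hR1.trans hyR.le
    obtain ⟨hplace, hrpow⟩ := h y hyw hyn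
    set t := B / (a * ‖y‖) with ht
    have ht0 : 0 ≤ t := by positivity
    have htB : t = B / a / ‖y‖ := by rw [ht, div_div]
    have ht2 : t ≤ 1 / 2 := by
      rw [htB, div_le_iff₀ hy0]
      have : 2 * B / a = 2 * (B / a) := by ring
      linarith
    have hwy : ∀ w, 0 < normAtPlace w y := fun w => (by positivity : 0 < a * ‖y‖).trans_le (hplace w)
    have hlog : ∀ w, 0 < normAtPlace w z ∧
        |Real.log (normAtPlace w z) - Real.log (normAtPlace w y)| ≤ 2 * t := by
      intro w
      refine abs_log_sub_log_le (hwy w) ht2 ?_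
      refine (abs_normAtPlace_sub_le w y z).trans (hyz.trans ?_)
      calc B = t * (a * ‖y‖) := by rw [ht]; field_simp
        _ ≤ t * normAtPlace w y := by gcongr; exact hplace w
    have hzn : mixedEmbedding.norm z ≠ 0 :=
      mixedEmbedding.norm_ne_zero_iff.mpr fun w => (hlog w).1.ne'
    have hzN : 0 < mixedEmbedding.norm z :=
      lt_of_le_of_ne (mixedEmbedding.norm_nonneg _) (Ne.symm hzn)
    have hL := abs_log_norm_sub_le hwy (fun w => (hlog w).1) (fun w => (hlog w).2)
    have hM := norm_logMap_sub_le (by positivity) hwy (fun w => (hlog w).1) (fun w => (hlog w).2)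
    have hW : |coneWeight y - coneWeight z| ≤ C₁ * (4 * (2 * t)) := by
      rw [abs_sub_comm]
      exact (h₁ y z).trans (by gcongr)
    have hP := norm_cpow_neg_sub_le hyN hzN hs2
    have hP' : ‖(mixedEmbedding.norm y : ℂ) ^ (-s) - (mixedEmbedding.norm z : ℂ) ^ (-s)‖ ≤
        mixedEmbedding.norm y ^ (-s.re) * (2 * (d * (2 * t)) * Real.exp (2 * d)) := by
      refine hP.trans ?_
      gcongr
      refine hL.trans ?_
      nlinarith
    have hsplit : weightedTerm s y - weightedTerm s z =
        ((coneWeight y - coneWeight z : ℝ) : ℂ) * (mixedEmbedding.norm y : ℂ) ^ (-s) +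
        (coneWeight z : ℂ) * ((mixedEmbedding.norm y : ℂ) ^ (-s) -
          (mixedEmbedding.norm z : ℂ) ^ (-s)) := by
      rw [weightedTerm, weightedTerm]; push_cast; ring
    have hmain : ‖weightedTerm s y - weightedTerm s z‖ ≤
        mixedEmbedding.norm y ^ (-s.re) * (C₂ / ‖y‖) := by
      rw [hsplit]
      refine (norm_add_le _ _).trans ?_
      rw [norm_mul, norm_mul, Complex.norm_real, Complex.norm_real, Real.norm_eq_abs,
        Real.norm_eq_abs, Complex.norm_cpow_eq_rpow_re_of_pos hyN, Complex.neg_re,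
        abs_of_nonneg (coneWeight_nonneg z)]
      have e : mixedEmbedding.norm y ^ (-s.re) * (C₂ / ‖y‖) =
          C₁ * (4 * (2 * t)) * mixedEmbedding.norm y ^ (-s.re) +
          1 * (mixedEmbedding.norm y ^ (-s.re) * (2 * (d * (2 * t)) * Real.exp (2 * d))) := by
        rw [htB]; simp only [C₂]; ring
      rw [e]
      gcongr
      exact coneWeight_le_one z
    have hre2 : s.re ≤ 2 := (Complex.re_le_norm s).trans hs2
    have hpow : mixedEmbedding.norm y ^ (-s.re) ≤ a ^ (-(d * 2)) * ‖y‖ ^ (-(d * σ)) := by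
      refine (hrpow _ hs0.le).trans ?_
      gcongr ?_ * ?_
      · exact Real.rpow_le_rpow_of_exponent_ge ha ha1 (by nlinarith)
      · exact Real.rpow_le_rpow_of_exponent_le hy1 (by nlinarith)
    have hfin : mixedEmbedding.norm y ^ (-s.re) * (C₂ / ‖y‖) ≤
        a ^ (-(d * 2)) * C₂ * ‖y‖ ^ (-(d * σ + 1)) := by
      have e : ‖y‖ ^ (-(d * σ + 1)) = ‖y‖ ^ (-(d * σ)) * ‖y‖⁻¹ := by
        rw [neg_add, Real.rpow_add hy0, Real.rpow_neg_one]
      rw [e]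
      calc _ ≤ a ^ (-(d * 2)) * ‖y‖ ^ (-(d * σ)) * (C₂ / ‖y‖) := by gcongr
        _ = _ := by ring
    have h3 : 0 ≤ 2 * R ^ (d * σ + 1) * ‖y‖ ^ (-(d * σ + 1)) := by positivity
    linarith

lemma exists_norm_weightedTerm_sub_le (K : Type) [Field K] [NumberField K]
    {B σ : ℝ} (hB : 0 < B) (hσ : 0 < σ) :
    ∃ C : ℝ, ∀ s : ℂ, σ ≤ s.re → ‖s‖ ≤ 2 → ∀ y z : mixedSpace K,
      (mixedEmbedding.norm y = 0 ∨ 1 ≤ mixedEmbedding.norm y) →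
      (mixedEmbedding.norm z = 0 ∨ 1 ≤ mixedEmbedding.norm z) →
      ‖z - y‖ ≤ B →
      ‖weightedTerm s y - weightedTerm s z‖ ≤ C * (‖y‖ ^ (-(Module.finrank ℚ K * σ + 1)) +
        ‖z‖ ^ (-(Module.finrank ℚ K * σ + 1))) := by
  obtain ⟨C, hC, h⟩ := exists_norm_weightedTerm_sub_le_of_ne_zero K hB hσ
  refine ⟨C, fun s hs hs2 y z hy hz hyz => ?_⟩
  have hp : ∀ y : mixedSpace K, 0 ≤ C * ‖y‖ ^ (-(Module.finrank ℚ K * σ + 1)) := fun y => by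
    positivity
  rw [mul_add]
  by_cases h1 : weightedTerm s y = 0
  · by_cases h2 : weightedTerm s z = 0
    · rw [h1, h2, sub_self, norm_zero]
      exact add_nonneg (hp y) (hp z)
    · have := h s hs hs2 z y hz hy (by rwa [norm_sub_rev]) h2
      rw [norm_sub_rev]
      linarith [hp y]
  · have := h s hs hs2 y z hy hz hyz h1
    linarith [hp z]

end WeightedTerm

section Doubling

lemma exists_differentiableOn_of_doubling {ι : Type*} [Fintype ι] (F : ℂ → (ι → ℤ) → ℂ)
    {U : Set ℂ} (hU : IsOpen U) (hdiff : ∀ n, DifferentiableOn ℂ (fun s => F s n) U)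
    (hdouble : ∀ s ∈ U, ∀ n, F s (2 • n) = (2 : ℂ) ^ (-(Fintype.card ι * s)) * F s n)
    (hbound : ∀ ε : ι → Fin 2, ∃ u : (ι → ℤ) → ℝ, Summable u ∧ ∀ s ∈ U, ∀ n,
      ‖F s (2 • n) - F s (2 • n + fun i => ((ε i : ℕ) : ℤ))‖ ≤ u n)
    (hsum : ∀ s ∈ U, 1 < s.re → Summable (F s)) :
    ∃ H : ℂ → ℂ, DifferentiableOn ℂ H U ∧ ∀ s ∈ U, 1 < s.re →
      H s = ((2 : ℂ) ^ (Fintype.card ι - Fintype.card ι * s) - 1) * ∑' n, F s n := by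
  choose u hu hub using hbound
  refine ⟨fun s => ∑ ε : ι → Fin 2, ∑' n, (F s (2 • n) - F s (2 • n + fun i => ((ε i : ℕ) : ℤ))),
    ?_, fun s hs hs1 => ?_⟩
  · refine DifferentiableOn.fun_sum fun ε _ => ?_
    refine Complex.differentiableOn_tsum_of_summable_norm (hu ε) (fun n => ?_) hU
      fun n s hs => hub ε s hs n
    exact (hdiff _).sub (hdiff _)
  · have hS := hsum s hs hs1
    let e : (ι → ℤ) × (ι → Fin 2) ≃ (ι → ℤ) :=
      (Equiv.arrowProdEquivProdArrow ι (fun _ => ℤ) (fun _ => Fin 2)).symm.trans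
        (Equiv.piCongrRight fun _ => (Int.divModEquiv 2).symm)
    have he : ∀ n ε, e (n, ε) = 2 • n + fun i => ((ε i : ℕ) : ℤ) := by
      intro n ε
      ext i
      simp [e, Equiv.arrowProdEquivProdArrow, Int.divModEquiv, mul_comm]
    have hS' : Summable fun x : (ι → Fin 2) × (ι → ℤ) => F s (e (x.2, x.1)) :=
      ((e.summable_iff (f := F s)).mpr hS).comp_injective (Equiv.prodComm _ _).injective
    have h1 : ∑' n, F s n = ∑ ε : ι → Fin 2, ∑' n, F s (2 • n + fun i => ((ε i : ℕ) : ℤ)) := by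
      rw [← e.tsum_eq (F s), ← (Equiv.prodComm _ _).tsum_eq]
      have h := hS'.tsum_prod
      simp_rw [← he]
      rw [← tsum_fintype (L := .unconditional _)]
      exact h
    have h2 : Summable fun n => F s (2 • n) := by
      simp_rw [hdouble s hs]
      exact hS.mul_left _
    have h3 : ∀ ε : ι → Fin 2, Summable fun n => F s (2 • n + fun i => ((ε i : ℕ) : ℤ)) := by
      intro ε
      have := hS'.prod_factor ε
      simpa only [he] using this
    have h4 : ∑' n, F s (2 • n) =
        (2 : ℂ) ^ (-(Fintype.card ι * s)) * ∑' n, F s n := by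
      rw [← tsum_mul_left]
      exact tsum_congr fun n => hdouble s hs n
    have h5 : ∑ ε : ι → Fin 2,
        ∑' n, (F s (2 • n) - F s (2 • n + fun i => ((ε i : ℕ) : ℤ))) =
        ∑ ε : ι → Fin 2, (∑' n, F s (2 • n) - ∑' n, F s (2 • n + fun i => ((ε i : ℕ) : ℤ))) :=
      Finset.sum_congr rfl fun ε _ => h2.tsum_sub (h3 ε)
    refine h5.trans ?_
    rw [Finset.sum_sub_distrib, ← h1, Finset.sum_const, h4, sub_mul, one_mul, Complex.cpow_sub _ _ two_ne_zero, Complex.cpow_natCast,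
      Complex.cpow_neg]
    have hc : Fintype.card (ι → Fin 2) = 2 ^ Fintype.card ι := by
      rw [← Nat.card_eq_fintype_card]
      simp
    rw [Finset.card_univ, hc, nsmul_eq_mul]
    push_cast
    ring

open NumberField.mixedEmbedding NumberField.InfinitePlace NumberField.Units
  NumberField.Units.dirichletUnitTheorem

variable (K : Type) [Field K] [NumberField K]

/-- The embedding of the ring of integers in the mixed space. -/
def integerEmbedding : 𝓞 K →+* mixedSpace K :=
  (mixedEmbedding K).comp (algebraMap (𝓞 K) K)

variable {K}

lemma integerEmbedding_injective : Function.Injective (integerEmbedding K) :=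
  (mixedEmbedding_injective K).comp RingOfIntegers.coe_injective

lemma norm_integerEmbedding (x : 𝓞 K) :
    mixedEmbedding.norm (integerEmbedding K x) = Ideal.absNorm (Ideal.span {x}) := by
  rw [Ideal.absNorm_span_singleton]
  simp only [integerEmbedding, RingHom.comp_apply, mixedEmbedding.norm_eq_norm]
  rw [← Algebra.coe_norm_int]
  simp [Nat.cast_natAbs]

lemma norm_integerEmbedding_eq_zero_or (x : 𝓞 K) :
    mixedEmbedding.norm (integerEmbedding K x) = 0 ∨
      1 ≤ mixedEmbedding.norm (integerEmbedding K x) := by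
  rw [norm_integerEmbedding]
  rcases Nat.eq_zero_or_pos (Ideal.absNorm (Ideal.span {x})) with h | h
  · left; exact_mod_cast h
  · right; exact_mod_cast h

lemma integerEmbedding_mem (x : 𝓞 K) :
    integerEmbedding K x ∈ mixedEmbedding.integerLattice K := by
  simp only [mixedEmbedding.integerLattice, LinearMap.mem_range]
  exact ⟨x, rfl⟩

lemma summable_norm_integerEmbedding {p : ℝ} (hp : Module.finrank ℚ K < p) :
    Summable fun x : 𝓞 K => ‖integerEmbedding K x‖ ^ (-p) := by
  have h := ZLattice.summable_norm_rpow (mixedEmbedding.integerLattice K) (-p) (by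
    rw [ZLattice.rank ℝ, mixedEmbedding.finrank]; linarith)
  have hf : Function.Injective (fun x : 𝓞 K =>
      (⟨integerEmbedding K x, integerEmbedding_mem x⟩ : mixedEmbedding.integerLattice K)) :=
    fun x y hxy => integerEmbedding_injective (congrArg Subtype.val hxy)
  have := h.comp_injective hf
  exact this

lemma summable_weightedTerm {s : ℂ} (hs : 1 < s.re) :
    Summable fun x : 𝓞 K => weightedTerm s (integerEmbedding K x) := by
  obtain ⟨C, hC⟩ := exists_norm_weightedTerm_le K s (by linarith)
  have hd : (0 : ℝ) < Module.finrank ℚ K := by exact_mod_cast Module.finrank_pos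
  exact Summable.of_norm_bounded
    ((summable_norm_integerEmbedding (by nlinarith)).mul_left C) fun x => hC _

lemma weightedTerm_two_smul {s : ℂ} (hs : 0 < s.re) (y : mixedSpace K) :
    weightedTerm s ((2 : ℕ) • y) = (2 : ℂ) ^ (-(Module.finrank ℚ K * s)) * weightedTerm s y := by
  have e : (2 : ℕ) • y = (2 : ℝ) • y := by rw [two_nsmul, two_smul]
  by_cases hn : mixedEmbedding.norm y = 0
  · rw [weightedTerm_eq_zero_of_norm hs hn, mul_zero, weightedTerm_eq_zero_of_norm hs]
    rw [e, mixedEmbedding.norm_smul, hn, mul_zero]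
  · have h1 : coneWeight ((2 : ℕ) • y) = coneWeight y := by
      rw [coneWeight, e, logMap_real_smul hn two_ne_zero, coneWeight]
    rw [weightedTerm, h1, weightedTerm, e, mixedEmbedding.norm_smul, Complex.ofReal_mul,
      Complex.mul_cpow_ofReal_nonneg (by positivity) (mixedEmbedding.norm_nonneg _)]
    have h2 : (((|2| : ℝ) ^ Module.finrank ℚ K : ℝ) : ℂ) ^ (-s) =
        (2 : ℂ) ^ (-(Module.finrank ℚ K * s)) := by
      rw [Complex.cpow_def_of_ne_zero (by norm_num), Complex.cpow_def_of_ne_zero two_ne_zero,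
        ← Complex.ofReal_log (by positivity), Real.log_pow, abs_two]
      push_cast
      rw [Complex.ofReal_log (by norm_num)]
      push_cast
      ring_nf
    rw [h2]
    ring

variable (K) in
/-- A neighbourhood of `1` on which the doubled lattice sums converge. -/
def doublingRegion : Set ℂ :=
  {s | 1 - 1 / (2 * (Module.finrank ℚ K : ℝ)) < s.re} ∩ {s | ‖s‖ < 2}

lemma isOpen_doublingRegion : IsOpen (doublingRegion K) :=
  (isOpen_lt continuous_const Complex.continuous_re).inter
    (isOpen_lt continuous_norm continuous_const)

lemma doublingRegion_abscissa_pos : 0 < 1 - 1 / (2 * (Module.finrank ℚ K : ℝ)) := by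
  have hd : (1 : ℝ) ≤ Module.finrank ℚ K := by exact_mod_cast Module.finrank_pos
  rw [sub_pos, div_lt_one (by linarith)]
  linarith

lemma re_pos_of_mem_doublingRegion {s : ℂ} (hs : s ∈ doublingRegion K) : 0 < s.re :=
  doublingRegion_abscissa_pos.trans hs.1

lemma one_mem_doublingRegion : 1 ∈ doublingRegion K := by
  have hd : (1 : ℝ) ≤ Module.finrank ℚ K := by exact_mod_cast Module.finrank_pos
  refine ⟨?_, by simp⟩
  simp only [Set.mem_ofPred_eq, Complex.one_re, sub_lt_self_iff]
  positivity

lemma differentiableOn_weightedTerm (y : mixedSpace K) :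
    DifferentiableOn ℂ (fun s => weightedTerm s y) {s | 0 < s.re} := by
  by_cases hn : mixedEmbedding.norm y = 0
  · exact (differentiableOn_const 0).congr fun s hs => weightedTerm_eq_zero_of_norm hs hn
  · refine DifferentiableOn.const_mul (fun s _ => ?_) _
    refine DifferentiableAt.differentiableWithinAt ?_
    exact differentiableAt_id.neg.const_cpow (Or.inl (by exact_mod_cast hn))

lemma exists_differentiableOn_tsum_weightedTerm {J : Ideal (𝓞 K)} (hJ : J ≠ ⊥) :
    ∃ H : ℂ → ℂ, DifferentiableOn ℂ H (doublingRegion K) ∧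
      ∀ s ∈ doublingRegion K, 1 < s.re → H s =
        ((2 : ℂ) ^ (Module.finrank ℚ K - Module.finrank ℚ K * s) - 1) *
          ∑' x : J, weightedTerm s (integerEmbedding K x) := by
  let b := Ideal.selfBasis (RingOfIntegers.basis K) J hJ
  have hcard : Fintype.card (Module.Free.ChooseBasisIndex ℤ (𝓞 K)) = Module.finrank ℚ K := by
    rw [← RingOfIntegers.rank, ← Module.finrank_eq_card_chooseBasisIndex]
  have hinj : Function.Injective fun n => ((b.equivFun.symm n : J) : 𝓞 K) :=
    Subtype.val_injective.comp b.equivFun.symm.injective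
  set d := Module.finrank ℚ K with hd
  have hd1 : (1 : ℝ) ≤ d := by exact_mod_cast Module.finrank_pos
  have hp : (d : ℝ) < d * (1 - 1 / (2 * (d : ℝ))) + 1 := by
    field_simp
    linarith
  have key := exists_differentiableOn_of_doubling
    (fun s n => weightedTerm s (integerEmbedding K (b.equivFun.symm n : J)))
    (isOpen_doublingRegion (K := K))
    (fun n => (differentiableOn_weightedTerm _).mono fun s hs => re_pos_of_mem_doublingRegion hs)
    ?_ ?_ ?_
  · obtain ⟨H, hH, hH'⟩ := key
    refine ⟨H, hH, fun s hs hs1 => ?_⟩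
    rw [hH' s hs hs1, hcard]
    congr 1
    exact b.equivFun.symm.toEquiv.tsum_eq (fun x : J => weightedTerm s (integerEmbedding K x))
  · intro s hs n
    rw [hcard, ← weightedTerm_two_smul (re_pos_of_mem_doublingRegion hs)]
    simp only [map_nsmul, Submodule.coe_smul_of_tower]
  · intro ε
    obtain ⟨C, hC⟩ := exists_norm_weightedTerm_sub_le K
      (B := ‖integerEmbedding K (b.equivFun.symm fun i => ((ε i : ℕ) : ℤ) : J)‖ + 1)
      (by positivity) (doublingRegion_abscissa_pos (K := K))
    have hs := summable_norm_integerEmbedding hp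
    have h1 := hs.comp_injective (hinj.comp (g := fun n => ((b.equivFun.symm n : J) : 𝓞 K))
      (f := fun n => 2 • n) (smul_right_injective _ two_ne_zero))
    have h2 := hs.comp_injective (hinj.comp (g := fun n => ((b.equivFun.symm n : J) : 𝓞 K))
      (f := fun n => 2 • n + fun i => ((ε i : ℕ) : ℤ))
      ((add_left_injective _).comp (smul_right_injective _ two_ne_zero)))
    refine ⟨_, (h1.add h2).mul_left C, fun s hs n => ?_⟩
    refine hC s hs.1.le hs.2.le _ _ (norm_integerEmbedding_eq_zero_or _)
      (norm_integerEmbedding_eq_zero_or _) ?_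
    rw [← map_sub, map_add, Submodule.coe_add, add_sub_cancel_left]
    linarith
  · intro s hs hs1
    exact (summable_weightedTerm hs1).comp_injective hinj

end Doubling

section UnitFolding

lemma exists_finset_sum_tent (c : ℝ) :
    ∃ S : Finset ℤ, (∀ n ∉ S, tent (n + c) = 0) ∧ ∑ n ∈ S, tent (n + c) = 1 := by
  have h0 := Int.floor_le c
  have h1 := Int.lt_floor_add_one c
  refine ⟨{-⌊c⌋, -⌊c⌋ - 1}, fun n hn => ?_, ?_⟩
  · by_contra h
    have h2 := abs_lt.mp (abs_lt_one_of_tent_ne_zero h)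
    have h3 : n < -⌊c⌋ + 1 := by
      have : (n : ℝ) < ((-⌊c⌋ + 1 : ℤ) : ℝ) := by push_cast; linarith
      exact_mod_cast this
    have h4 : -⌊c⌋ - 2 < n := by
      have : ((-⌊c⌋ - 2 : ℤ) : ℝ) < (n : ℝ) := by push_cast; linarith
      exact_mod_cast this
    simp only [Finset.mem_insert, Finset.mem_singleton] at hn
    omega
  · rw [Finset.sum_pair (by omega)]
    push_cast
    rw [tent, tent, abs_of_nonneg (by linarith), abs_of_nonpos (by linarith),
      max_eq_right (by linarith), max_eq_right (by linarith)]
    ring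

lemma hasSum_prod_tent {ι : Type*} [Fintype ι] (c : ι → ℝ) :
    HasSum (fun n : ι → ℤ => ∏ i, tent (n i + c i)) 1 := by
  choose S hS hS1 using fun i => exists_finset_sum_tent (c i)
  have h : ∑ n ∈ Fintype.piFinset S, ∏ i, tent (n i + c i) = 1 := by
    rw [← Finset.prod_univ_sum S fun i n => tent (n + c i)]
    exact Finset.prod_eq_one fun i _ => hS1 i
  rw [← h]
  refine hasSum_sum_of_ne_finset_zero fun n hn => ?_
  rw [Fintype.mem_piFinset] at hn
  push Not at hn
  obtain ⟨i, hi⟩ := hn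
  exact Finset.prod_eq_zero (Finset.mem_univ i) (hS i _ hi)

lemma hasSum_comp_snd {α β : Type*} {g : β → ℝ} {a b : ℝ} (h : HasSum (fun _ : α => (1 : ℝ)) a)
    (hg : HasSum g b) (h0 : ∀ n, 0 ≤ g n) : HasSum (fun p : α × β => g p.2) (a * b) := by
  have h1 := h.mul hg (h.summable.mul_of_nonneg hg.summable (fun _ => zero_le_one) h0)
  simpa only [one_mul] using h1

open NumberField.mixedEmbedding NumberField.InfinitePlace NumberField.Units
  NumberField.Units.dirichletUnitTheorem

variable {K : Type} [Field K] [NumberField K]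

lemma unitBasis_repr_logEmbedding (ζ : torsion K) (n : Fin (rank K) → ℤ) (i : Fin (rank K)) :
    (unitBasis K).repr (logEmbedding K (Additive.ofMul ((ζ : (𝓞 K)ˣ) *
      ∏ i, fundSystem K i ^ n i))) i = n i := by
  have h1 : logEmbedding K (Additive.ofMul (ζ : (𝓞 K)ˣ)) = 0 :=
    logEmbedding_eq_zero_iff.mpr ζ.2
  have h2 : ∀ j, logEmbedding K (Additive.ofMul (fundSystem K j)) = unitBasis K j := fun j => by
    rw [logEmbedding_fundSystem, unitBasis, Module.Basis.ofZLatticeBasis_apply]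
  rw [ofMul_mul, map_add, h1, zero_add, ofMul_prod, map_sum, map_sum, Finsupp.finsetSum_apply]
  have h3 : ∀ j, (unitBasis K).repr (logEmbedding K (Additive.ofMul (fundSystem K j ^ n j))) i =
      if j = i then (n j : ℝ) else 0 := fun j => by
    rw [ofMul_zpow, map_zsmul, h2, map_zsmul, Module.Basis.repr_self, Finsupp.smul_apply,
      Finsupp.single_apply]
    split_ifs <;> simp
  simp_rw [h3]
  simp

variable (K) in
/-- Coordinates of units with respect to roots of unity and fundamental units. -/
def unitCoordEquiv : torsion K × (Fin (rank K) → ℤ) ≃ (𝓞 K)ˣ :=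
  Equiv.ofBijective (fun p => (p.1 : (𝓞 K)ˣ) * ∏ i, fundSystem K i ^ p.2 i) <| by
    rw [Function.bijective_iff_existsUnique]
    intro u
    obtain ⟨p, hp, hp'⟩ := exist_unique_eq_mul_prod K u
    exact ⟨p, hp.symm, fun q hq => hp' q hq.symm⟩

lemma coneWeight_unitCoordEquiv_smul {x : mixedSpace K} (hx : mixedEmbedding.norm x ≠ 0)
    (p : torsion K × (Fin (rank K) → ℤ)) : coneWeight (unitCoordEquiv K p • x) =
      ∏ i, tent (p.2 i + (unitBasis K).repr (logMap x) i) := by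
  rw [coneWeight, logMap_unit_smul _ hx]
  refine Finset.prod_congr rfl fun i _ => ?_
  rw [map_add, Finsupp.add_apply]
  congr 2
  exact unitBasis_repr_logEmbedding p.1 p.2 i

variable (K) in
lemma hasSum_torsion_one : HasSum (fun _ : torsion K => (1 : ℝ)) (torsionOrder K) := by
  have h : Summable fun _ : torsion K => (1 : ℝ) :=
    summable_of_hasFiniteSupport (Set.toFinite _)
  have h0 := h.hasSum
  rwa [tsum_const, nsmul_one] at h0

lemma hasSum_coneWeight_unit_smul {x : mixedSpace K} (hx : mixedEmbedding.norm x ≠ 0) :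
    HasSum (fun u : (𝓞 K)ˣ => coneWeight (u • x)) (torsionOrder K) := by
  have h := hasSum_comp_snd (hasSum_torsion_one K)
    (hasSum_prod_tent fun i => (unitBasis K).repr (logMap x) i)
    fun n => Finset.prod_nonneg fun i _ => tent_nonneg _
  rw [mul_one] at h
  rw [← Equiv.hasSum_iff (unitCoordEquiv K)]
  refine Eq.subst (motive := fun f => HasSum f _) ?_ h
  exact funext fun p => (coneWeight_unitCoordEquiv_smul hx p).symm

lemma integerEmbedding_unit_mul (u : (𝓞 K)ˣ) (x : 𝓞 K) :
    integerEmbedding K (u * x) = u • integerEmbedding K x := by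
  rw [map_mul]
  rfl

variable (K) in
/-- The terms of the Dedekind zeta series. -/
def zetaTerm (s : ℂ) (I : {I : Ideal (𝓞 K) // I ≠ ⊥}) : ℂ := (Ideal.absNorm I.1 : ℂ) ^ (-s)

variable (K) in
/-- An integral ideal in the inverse of a given ideal class. -/
def inverseClassIdeal (C : ClassGroup (𝓞 K)) : nonZeroDivisors (Ideal (𝓞 K)) :=
  (ClassGroup.mk0_surjective C⁻¹).choose

lemma mk0_inverseClassIdeal (C : ClassGroup (𝓞 K)) :
    ClassGroup.mk0 (inverseClassIdeal K C) = C⁻¹ :=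
  (ClassGroup.mk0_surjective C⁻¹).choose_spec

lemma mk0_eq_one_iff_isPrincipal (I : nonZeroDivisors (Ideal (𝓞 K))) :
    ClassGroup.mk0 I = 1 ↔ (I : Ideal (𝓞 K)).IsPrincipal :=
  ClassGroup.mk0_eq_one_iff I.2

lemma coe_nonZeroDivisors_ne_zero (I : nonZeroDivisors (Ideal (𝓞 K))) : (I : Ideal (𝓞 K)) ≠ 0 :=
  nonZeroDivisors.ne_zero I.2

/-- The ideal class of a nonzero integral ideal. -/
def idealClass (I : {I : Ideal (𝓞 K) // I ≠ ⊥}) : ClassGroup (𝓞 K) :=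
  ClassGroup.mk0 ⟨I.1, mem_nonZeroDivisors_of_ne_zero I.2⟩

lemma exists_span_singleton_eq_mul (I : {I : Ideal (𝓞 K) // I ≠ ⊥}) :
    ∃ x : 𝓞 K, Ideal.span {x} = I.1 * (inverseClassIdeal K (idealClass I) : Ideal (𝓞 K)) := by
  have h : ClassGroup.mk0 ((⟨I.1, mem_nonZeroDivisors_of_ne_zero I.2⟩ :
      nonZeroDivisors (Ideal (𝓞 K))) * inverseClassIdeal K (idealClass I)) = 1 := by
    rw [map_mul, mk0_inverseClassIdeal, idealClass, mul_inv_cancel]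
  obtain ⟨x, hx⟩ := ((mk0_eq_one_iff_isPrincipal _).mp h).principal
  exact ⟨x, hx.symm⟩

/-- A generator of the product of `I` with the chosen ideal in the inverse class. -/
def classGenerator (I : {I : Ideal (𝓞 K) // I ≠ ⊥}) : 𝓞 K :=
  (exists_span_singleton_eq_mul I).choose

lemma span_classGenerator (I : {I : Ideal (𝓞 K) // I ≠ ⊥}) :
    Ideal.span {classGenerator I} =
      I.1 * (inverseClassIdeal K (idealClass I) : Ideal (𝓞 K)) :=
  (exists_span_singleton_eq_mul I).choose_spec

lemma classGenerator_ne_zero (I : {I : Ideal (𝓞 K) // I ≠ ⊥}) : classGenerator I ≠ 0 := by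
  intro h
  have h1 := span_classGenerator I
  rw [h, Ideal.span_singleton_eq_bot.mpr rfl] at h1
  exact mul_ne_zero I.2 (coe_nonZeroDivisors_ne_zero _) h1.symm

/-- The terms of the sum over lattice points, one lattice for every ideal class. -/
def latticeTerm (s : ℂ) (p : ClassGroup (𝓞 K) × 𝓞 K) : ℂ :=
  (Ideal.absNorm (inverseClassIdeal K p.1 : Ideal (𝓞 K)) : ℂ) ^ s *
    ((inverseClassIdeal K p.1 : Ideal (𝓞 K)) : Set (𝓞 K)).indicator
      (fun x => weightedTerm s (integerEmbedding K x)) p.2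

/-- A nonzero ideal and a unit determine an ideal class and a lattice point. -/
def latticePoint (p : {I : Ideal (𝓞 K) // I ≠ ⊥} × (𝓞 K)ˣ) : ClassGroup (𝓞 K) × 𝓞 K :=
  (idealClass p.1, p.2 * classGenerator p.1)

lemma latticePoint_injective : Function.Injective (latticePoint (K := K)) := by
  rintro ⟨I, u⟩ ⟨J, v⟩ h
  obtain ⟨h1, h2⟩ := Prod.mk.inj h
  have h3 := congrArg (fun x : 𝓞 K => Ideal.span {x}) h2
  simp only [Ideal.span_singleton_mul_left_unit u.isUnit,
    Ideal.span_singleton_mul_left_unit v.isUnit, span_classGenerator, h1] at h3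
  have h4 : I = J :=
    Subtype.ext (mul_right_cancel₀ (coe_nonZeroDivisors_ne_zero _) h3)
  subst h4
  exact Prod.ext rfl (Units.ext (mul_right_cancel₀ (classGenerator_ne_zero I) h2))

lemma support_latticeTerm_subset {s : ℂ} (hs : 0 < s.re) :
    Function.support (latticeTerm (K := K) s) ⊆ Set.range latticePoint := by
  rintro ⟨C, x⟩ hx
  have h1 := right_ne_zero_of_mul hx
  have hxJ : x ∈ (inverseClassIdeal K C : Ideal (𝓞 K)) := Set.mem_of_indicator_ne_zero h1
  have hx0 : x ≠ 0 := by
    rintro rfl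
    refine h1 ?_
    rw [Set.indicator_of_mem hxJ]
    exact weightedTerm_eq_zero_of_norm hs (by simp [mixedEmbedding.norm])
  obtain ⟨I, hI⟩ := Ideal.dvd_span_singleton.mpr hxJ
  have hI0 : I ≠ ⊥ := by
    rintro rfl
    rw [Ideal.mul_bot, Ideal.span_singleton_eq_bot] at hI
    exact hx0 hI
  have hc : idealClass ⟨I, hI0⟩ = C := by
    have h : ClassGroup.mk0 (inverseClassIdeal K C *
        (⟨I, mem_nonZeroDivisors_of_ne_zero hI0⟩ : nonZeroDivisors (Ideal (𝓞 K)))) = 1 :=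
      (mk0_eq_one_iff_isPrincipal _).mpr ⟨⟨x, hI.symm⟩⟩
    rw [map_mul, mk0_inverseClassIdeal] at h
    exact (inv_mul_eq_one.mp h).symm
  have h2 := span_classGenerator ⟨I, hI0⟩
  rw [hc, mul_comm, ← hI, Ideal.span_singleton_eq_span_singleton] at h2
  obtain ⟨u, hu⟩ := h2
  exact ⟨(⟨I, hI0⟩, u), Prod.ext hc (by rw [← hu, latticePoint, mul_comm])⟩

lemma latticeTerm_latticePoint (s : ℂ) (p : {I : Ideal (𝓞 K) // I ≠ ⊥} × (𝓞 K)ˣ) :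
    latticeTerm s (latticePoint p) = zetaTerm K s p.1 *
      (coneWeight (p.2 • integerEmbedding K (classGenerator p.1)) : ℝ) := by
  obtain ⟨I, u⟩ := p
  have hmem : (u : 𝓞 K) * classGenerator I ∈
      (inverseClassIdeal K (idealClass I) : Ideal (𝓞 K)) := by
    refine Ideal.mul_mem_left _ _ (Ideal.dvd_span_singleton.mp ?_)
    rw [span_classGenerator]
    exact dvd_mul_left _ _
  have hJ : (Ideal.absNorm (inverseClassIdeal K (idealClass I) : Ideal (𝓞 K)) : ℂ) ≠ 0 := by
    exact_mod_cast fun h => coe_nonZeroDivisors_ne_zero _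
      (Ideal.absNorm_eq_zero_iff.mp h)
  simp only [latticeTerm, latticePoint, zetaTerm]
  rw [Set.indicator_of_mem hmem, weightedTerm, norm_integerEmbedding,
    Ideal.span_singleton_mul_left_unit u.isUnit, span_classGenerator,
    integerEmbedding_unit_mul, map_mul, Nat.cast_mul, Complex.ofReal_mul,
    Complex.mul_cpow_ofReal_nonneg (by positivity) (by positivity), Complex.ofReal_natCast,
    Complex.ofReal_natCast, Complex.cpow_neg _ s, Complex.cpow_neg _ s]
  have hJ' := (Complex.cpow_ne_zero_iff (y := s)).mpr (Or.inl hJ)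
  field_simp

lemma norm_integerEmbedding_ne_zero {x : 𝓞 K} (hx : x ≠ 0) :
    mixedEmbedding.norm (integerEmbedding K x) ≠ 0 := by
  rw [norm_integerEmbedding, Nat.cast_ne_zero, Ne, Ideal.absNorm_eq_zero_iff,
    Ideal.span_singleton_eq_bot]
  exact hx

lemma summable_latticeTerm {s : ℂ} (hs : 1 < s.re) : Summable (latticeTerm (K := K) s) := by
  have h1 : ∀ C, Summable fun x => ‖latticeTerm (K := K) s (C, x)‖ := fun C => by
    simp only [latticeTerm]
    exact (((summable_weightedTerm hs).indicator _).mul_left _).norm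
  have h2 : Summable fun p => ‖latticeTerm (K := K) s p‖ := by
    rw [summable_prod_of_nonneg fun _ => norm_nonneg _]
    exact ⟨h1, (hasSum_fintype _).summable⟩
  exact h2.of_norm

end UnitFolding

section Pole

lemma eqOn_punctured_ball {f g : ℂ → ℂ} {c : ℂ} {r : ℝ} (hr : 0 < r)
    (hf : DifferentiableOn ℂ f (Metric.ball c r \ {c}))
    (hg : DifferentiableOn ℂ g (Metric.ball c r \ {c}))
    (h : ∀ s ∈ Metric.ball c r, c.re < s.re → f s = g s) :
    Set.EqOn f g (Metric.ball c r \ {c}) := by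
  set U : Set ℂ := {w | w.re < Real.log r} with hU
  have hUo : IsOpen U := isOpen_lt Complex.continuous_re continuous_const
  have hmaps : Set.MapsTo (fun w => c + Complex.exp w) U (Metric.ball c r \ {c}) := by
    intro w hw
    refine ⟨?_, by simp⟩
    rw [Metric.mem_ball, dist_eq_norm, add_sub_cancel_left, Complex.norm_exp]
    exact (Real.lt_log_iff_exp_lt hr).mp hw
  have hd : DifferentiableOn ℂ (fun w => c + Complex.exp w) U :=
    (Complex.differentiable_exp.const_add c).differentiableOn
  have key := ((hf.comp hd hmaps).analyticOnNhd hUo).eqOn_of_preconnected_of_eventuallyEq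
    ((hg.comp hd hmaps).analyticOnNhd hUo) (convex_halfSpace_re_lt _).isPreconnected
    (z₀ := (Real.log (r / 2) : ℝ)) ?_ ?_
  · intro s hs
    have h1 : s - c ≠ 0 := sub_ne_zero.mpr hs.2
    have h2 : Complex.log (s - c) ∈ U := by
      rw [hU, Set.mem_ofPred_eq, Complex.log_re]
      exact Real.log_lt_log (norm_pos_iff.mpr h1) (by simpa [dist_eq_norm] using hs.1)
    have h3 := key h2
    simpa only [Function.comp_apply, Complex.exp_log h1, add_sub_cancel] using h3
  · rw [hU, Set.mem_ofPred_eq, Complex.ofReal_re]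
    exact Real.log_lt_log (by positivity) (by linarith)
  · have h1 : 0 < (Complex.exp (Real.log (r / 2) : ℝ)).re := by
      rw [← Complex.ofReal_exp, Complex.ofReal_re]
      exact Real.exp_pos _
    have h2 : ∀ᶠ w in 𝓝 ((Real.log (r / 2) : ℝ) : ℂ), 0 < (Complex.exp w).re :=
      (Complex.continuous_re.comp Complex.continuous_exp).continuousAt.eventually
        (lt_mem_nhds h1)
    have h3 : U ∈ 𝓝 ((Real.log (r / 2) : ℝ) : ℂ) := hUo.mem_nhds (by
      rw [hU, Set.mem_ofPred_eq, Complex.ofReal_re]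
      exact Real.log_lt_log (by positivity) (by linarith))
    filter_upwards [h2, h3] with w hw hw'
    exact h _ (hmaps hw').1 (by rw [Complex.add_re]; linarith)

open NumberField.mixedEmbedding NumberField.InfinitePlace NumberField.Units
  NumberField.Units.dirichletUnitTheorem

variable {K : Type} [Field K] [NumberField K]

lemma hasSum_latticeTerm_unit (s : ℂ) (I : {I : Ideal (𝓞 K) // I ≠ ⊥}) :
    HasSum (fun u => latticeTerm s (latticePoint (I, u))) (zetaTerm K s I * torsionOrder K) := by
  simp_rw [latticeTerm_latticePoint]
  have h := Complex.hasSum_ofReal.mpr (hasSum_coneWeight_unit_smul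
    (norm_integerEmbedding_ne_zero (classGenerator_ne_zero I)))
  rw [Complex.ofReal_natCast] at h
  exact h.mul_left _

lemma summable_latticeTerm_latticePoint {s : ℂ} (hs : 1 < s.re) :
    Summable fun p => latticeTerm s (latticePoint (K := K) p) :=
  (summable_latticeTerm hs).comp_injective latticePoint_injective

variable (K) in
lemma summable_zetaTerm {s : ℂ} (hs : 1 < s.re) : Summable (zetaTerm K s) := by
  have h := (summable_latticeTerm_latticePoint (K := K) hs).prod
  simp_rw [fun I => (hasSum_latticeTerm_unit (K := K) s I).tsum_eq] at h
  have h0 : (torsionOrder K : ℂ) ≠ 0 := Nat.cast_ne_zero.mpr (torsionOrder_ne_zero K)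
  exact (summable_mul_right_iff h0).mp h

lemma tsum_zetaTerm_mul_torsionOrder {s : ℂ} (hs : 1 < s.re) :
    (∑' I, zetaTerm K s I) * torsionOrder K =
      ∑ C : ClassGroup (𝓞 K), (Ideal.absNorm (inverseClassIdeal K C : Ideal (𝓞 K)) : ℂ) ^ s *
        ∑' x : (inverseClassIdeal K C : Ideal (𝓞 K)), weightedTerm s (integerEmbedding K x) := by
  have h1 := (summable_latticeTerm_latticePoint (K := K) hs).tsum_prod
  simp_rw [fun I => (hasSum_latticeTerm_unit (K := K) s I).tsum_eq] at h1
  rw [tsum_mul_right] at h1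
  rw [← h1, latticePoint_injective.tsum_eq (support_latticeTerm_subset (by linarith)),
    (summable_latticeTerm hs).tsum_prod, tsum_fintype]
  refine Finset.sum_congr rfl fun C _ => ?_
  simp only [latticeTerm]
  rw [tsum_mul_left]
  congr 1
  exact (tsum_subtype ((inverseClassIdeal K C : Ideal (𝓞 K)) : Set (𝓞 K))
    fun x => weightedTerm s (integerEmbedding K x)).symm

variable (K) in
lemma exists_differentiableOn_tsum_zetaTerm :
    ∃ G : ℂ → ℂ, DifferentiableOn ℂ G (doublingRegion K) ∧
      ∀ s ∈ doublingRegion K, 1 < s.re → G s =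
        ((2 : ℂ) ^ (Module.finrank ℚ K - Module.finrank ℚ K * s) - 1) *
          (∑' I, zetaTerm K s I) := by
  choose H hH hH' using fun C : ClassGroup (𝓞 K) =>
    exists_differentiableOn_tsum_weightedTerm (coe_nonZeroDivisors_ne_zero (inverseClassIdeal K C))
  have h0 : (torsionOrder K : ℂ) ≠ 0 := Nat.cast_ne_zero.mpr (torsionOrder_ne_zero K)
  refine ⟨fun s => (∑ C, (Ideal.absNorm (inverseClassIdeal K C : Ideal (𝓞 K)) : ℂ) ^ s * H C s) /
    torsionOrder K, ?_, fun s hs hs1 => ?_⟩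
  · refine DifferentiableOn.div_const (DifferentiableOn.fun_sum fun C _ => ?_) _
    refine DifferentiableOn.mul (fun s _ => ?_) (hH C)
    refine DifferentiableAt.differentiableWithinAt (differentiableAt_id.const_cpow (Or.inl ?_))
    exact Nat.cast_ne_zero.mpr fun h =>
      coe_nonZeroDivisors_ne_zero _ (Ideal.absNorm_eq_zero_iff.mp h)
  · rw [div_eq_iff h0, mul_assoc, tsum_zetaTerm_mul_torsionOrder hs1, Finset.mul_sum]
    refine Finset.sum_congr rfl fun C _ => ?_
    rw [hH' C s hs hs1]
    ring

/-- The function `(s - 1) ζ_K(s)` is entire. -/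
lemma exists_differentiable_eq_sub_one_mul {Z : ℂ → ℂ} (hZ : IsDedekindZeta K Z) :
    ∃ W : ℂ → ℂ, Differentiable ℂ W ∧ ∀ s ≠ 1, W s = (s - 1) * Z s := by
  obtain ⟨G, hG, hG'⟩ := exists_differentiableOn_tsum_zetaTerm K
  obtain ⟨r, hr, hrU⟩ := Metric.isOpen_iff.mp (isOpen_doublingRegion (K := K)) 1
    one_mem_doublingRegion
  set d : ℂ := ((Module.finrank ℚ K : ℕ) : ℂ)
  have hd0 : d ≠ 0 := Nat.cast_ne_zero.mpr Module.finrank_pos.ne'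
  let q : ℂ → ℂ := fun s => (2 : ℂ) ^ (d - d * s) - 1
  have hq : ∀ s, HasDerivAt q ((2 : ℂ) ^ (d - d * s) * Complex.log 2 * (-(d * 1))) s := fun s =>
    ((((hasDerivAt_id s).const_mul d).const_sub d).const_cpow (Or.inl two_ne_zero)).sub_const 1
  have hqd : Differentiable ℂ q := fun s => (hq s).differentiableAt
  have hq1 : q 1 = 0 := by simp [q]
  have hk : Differentiable ℂ (dslope q 1) := by
    rw [← differentiableOn_univ, Complex.differentiableOn_dslope univ_mem]
    exact hqd.differentiableOn
  have hk1 : dslope q 1 1 ≠ 0 := by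
    rw [dslope_same, (hq 1).deriv]
    have hl : Complex.log 2 ≠ 0 := by
      rw [← Complex.ofReal_ofNat, ← Complex.ofReal_log (by norm_num)]
      exact_mod_cast (Real.log_pos one_lt_two).ne'
    simp [hd0, hl]
  have hqk : ∀ s, q s = (s - 1) * dslope q 1 s := fun s => by
    have := sub_smul_dslope q 1 s
    rw [hq1, sub_zero, smul_eq_mul] at this
    exact this.symm
  have hEq : Set.EqOn (fun s => q s * Z s) G (Metric.ball 1 r \ {1}) := by
    refine eqOn_punctured_ball hr (fun s hs => ?_)
      (hG.mono (Set.sdiff_subset.trans hrU)) fun s hs hs1 => ?_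
    · exact ((hqd s).mul (hZ.1 s hs.2)).differentiableWithinAt
    · rw [Complex.one_re] at hs1
      rw [hG' s (hrU hs) hs1, hZ.2 s hs1]
      rfl
  have hW : ∀ s ≠ 1, Function.update (fun s => (s - 1) * Z s) 1 (G 1 / dslope q 1 1) s =
      (s - 1) * Z s := fun s hs => Function.update_of_ne hs _ _
  refine ⟨Function.update (fun s => (s - 1) * Z s) 1 (G 1 / dslope q 1 1), fun s => ?_, hW⟩
  by_cases hs : s = 1
  · subst hs
    have h1 : DifferentiableAt ℂ (fun s => G s / dslope q 1 s) 1 :=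
      ((hG.mono hrU).differentiableAt (Metric.ball_mem_nhds 1 hr)).div (hk 1) hk1
    refine h1.congr_of_eventuallyEq ?_
    filter_upwards [Metric.ball_mem_nhds 1 hr, (hk 1).continuousAt.eventually_ne hk1] with s hs hs'
    by_cases h : s = 1
    · rw [h, Function.update_self]
    · rw [hW s h, eq_div_iff hs', ← hEq ⟨hs, h⟩]
      simp only [hqk]
      ring
  · have h1 : DifferentiableAt ℂ (fun s => (s - 1) * Z s) s :=
      (differentiableAt_id.sub_const 1).mul (hZ.1 s hs)
    refine h1.congr_of_eventuallyEq ?_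
    filter_upwards [isOpen_ne.mem_nhds hs] with t ht using hW t ht

end Pole

section Moebius

variable {K : Type} [Field K] [NumberField K]

lemma moebiusK_of_squarefree {I : Ideal (𝓞 K)} (h : Squarefree I) :
    moebiusK K I = (-1) ^ (UniqueFactorizationMonoid.normalizedFactors I).card := by
  rw [moebiusK, if_pos h, UniqueFactorizationMonoid.normalizedFactors, Multiset.card_map]

lemma moebiusK_of_not_squarefree {I : Ideal (𝓞 K)} (h : ¬ Squarefree I) : moebiusK K I = 0 :=
  if_neg h

lemma abs_moebiusK_le_one (I : Ideal (𝓞 K)) : |(moebiusK K I : ℝ)| ≤ 1 := by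
  by_cases h : Squarefree I
  · rw [moebiusK_of_squarefree h]
    simp
  · simp [moebiusK_of_not_squarefree h]

lemma moebiusK_one : moebiusK K 1 = 1 := by
  rw [moebiusK_of_squarefree squarefree_one, UniqueFactorizationMonoid.normalizedFactors_one]
  rfl

lemma squarefree_irreducible_mul {P I : Ideal (𝓞 K)} (hP : Irreducible P) (hI : Squarefree I)
    (h : ¬ P ∣ I) : Squarefree (P * I) :=
  squarefree_mul_iff.2 ⟨(hP.isRelPrime_iff_not_dvd).2 h, hP.squarefree, hI⟩

lemma moebiusK_irreducible_mul {P I : Ideal (𝓞 K)} (hP : Irreducible P) (hI : Squarefree I)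
    (h : ¬ P ∣ I) : moebiusK K (P * I) = -moebiusK K I := by
  rw [moebiusK_of_squarefree hI, moebiusK_of_squarefree (squarefree_irreducible_mul hP hI h),
    UniqueFactorizationMonoid.normalizedFactors_mul hP.ne_zero hI.ne_zero,
    UniqueFactorizationMonoid.normalizedFactors_irreducible hP, Multiset.card_add,
    Multiset.card_singleton, pow_add]
  ring

lemma tsum_moebiusK_dvd {L : Ideal (𝓞 K)} (hL : L ≠ 0) :
    ∑' I : Ideal (𝓞 K), (if I ∣ L then (moebiusK K I : ℂ) else 0) = if L = 1 then 1 else 0 := by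
  split_ifs with h1
  · subst h1
    rw [tsum_eq_single 1, if_pos (dvd_refl _), moebiusK_one, Int.cast_one]
    intro I hI
    rw [if_neg]
    exact fun h => hI (isUnit_iff_eq_one.1 (isUnit_of_dvd_one h))
  · have hfin : {I : Ideal (𝓞 K) | I ∣ L ∧ Squarefree I}.Finite :=
      (@Set.toFinite _ {I : Ideal (𝓞 K) | I ∣ L}
        (@Finite.of_fintype _ (UniqueFactorizationMonoid.fintypeSubtypeDvd L hL))).subset
        fun I h => h.1
    set S := hfin.toFinset with hS
    have hmem : ∀ I, I ∈ S ↔ I ∣ L ∧ Squarefree I := fun I => by simp [hS]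
    obtain ⟨P, hP, hPL⟩ := WfDvdMonoid.exists_irreducible_factor
      (fun h => h1 (isUnit_iff_eq_one.1 h)) hL
    rw [tsum_eq_sum (s := S)]
    · rw [Finset.sum_congr rfl (g := fun I => (moebiusK K I : ℂ))
        (fun I hI => if_pos ((hmem I).1 hI).1), ← Finset.sum_filter_not_add_sum_filter S (P ∣ ·),
        ← sub_neg_eq_add, sub_eq_zero, ← Finset.sum_neg_distrib]
      refine Finset.sum_bij (fun I _ => P * I) ?_ ?_ ?_ ?_
      · intro I hI
        simp only [Finset.mem_filter, hmem] at hI ⊢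
        exact ⟨⟨((hP.isRelPrime_iff_not_dvd).2 hI.2).mul_dvd hPL hI.1.1,
          squarefree_irreducible_mul hP hI.1.2 hI.2⟩, dvd_mul_right _ _⟩
      · intro I _ J _ h
        exact mul_left_cancel₀ hP.ne_zero h
      · intro J hJ
        simp only [Finset.mem_filter, hmem] at hJ
        obtain ⟨I, rfl⟩ := hJ.2
        refine ⟨I, ?_, rfl⟩
        simp only [Finset.mem_filter, hmem]
        have h2 := squarefree_mul_iff.1 hJ.1.2
        exact ⟨⟨(dvd_mul_left _ _).trans hJ.1.1, h2.2.2⟩, (hP.isRelPrime_iff_not_dvd).1 h2.1⟩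
      · intro I hI
        simp only [Finset.mem_filter, hmem] at hI
        rw [moebiusK_irreducible_mul hP hI.1.2 hI.2]
        simp
    · intro I hI
      rw [hmem, not_and] at hI
      split_ifs with h
      · rw [moebiusK_of_not_squarefree (hI h), Int.cast_zero]
      · rfl

lemma norm_moebiusK_mul_zetaTerm_le (s : ℂ) (I : {I : Ideal (𝓞 K) // I ≠ ⊥}) :
    ‖(moebiusK K I.1 : ℂ) * zetaTerm K s I‖ ≤ ‖zetaTerm K s I‖ := by
  rw [norm_mul]
  refine mul_le_of_le_one_left (norm_nonneg _) ?_
  have := abs_moebiusK_le_one I.1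
  rwa [← Real.norm_eq_abs, ← Complex.norm_real, Complex.ofReal_intCast] at this

lemma summable_norm_moebiusK_mul_zetaTerm {s : ℂ} (hs : 1 < s.re) :
    Summable fun I => ‖(moebiusK K I.1 : ℂ) * zetaTerm K s I‖ :=
  (summable_zetaTerm K hs).norm.of_nonneg_of_le (fun _ => norm_nonneg _)
    (norm_moebiusK_mul_zetaTerm_le s)

lemma tsum_moebiusK_mul_tsum_zetaTerm {s : ℂ} (hs : 1 < s.re) :
    (∑' I, (moebiusK K I.1 : ℂ) * zetaTerm K s I) * ∑' I, zetaTerm K s I = 1 := by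
  have hA := summable_norm_moebiusK_mul_zetaTerm (K := K) hs
  have hB := (summable_zetaTerm K hs).norm
  rw [tsum_mul_tsum_of_summable_norm hA hB]
  have hs2 := summable_mul_of_summable_norm hA hB
  let m : {I : Ideal (𝓞 K) // I ≠ ⊥} × {I : Ideal (𝓞 K) // I ≠ ⊥} → {I : Ideal (𝓞 K) // I ≠ ⊥} :=
    fun p => ⟨p.1.1 * p.2.1, mul_ne_zero p.1.2 p.2.2⟩
  rw [← (hs2.hasSum.tsum_fiberwise m).tsum_eq]
  have key : ∀ L : {I : Ideal (𝓞 K) // I ≠ ⊥},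
      ∑' p : m ⁻¹' {L}, ((moebiusK K p.1.1.1 : ℂ) * zetaTerm K s p.1.1) * zetaTerm K s p.1.2 =
        zetaTerm K s L * if L.1 = 1 then 1 else 0 := by
    intro L
    rw [← tsum_moebiusK_dvd L.2, ← tsum_mul_left]
    have hm : ∀ p : m ⁻¹' {L}, p.1.1.1 * p.1.2.1 = L.1 := fun p => congrArg Subtype.val p.2
    have hinj : Function.Injective fun p : m ⁻¹' {L} => p.1.1.1 := by
      intro p q h
      have h' : p.1.1.1 = q.1.1.1 := h
      have h1 : p.1.1.1 * p.1.2.1 = p.1.1.1 * q.1.2.1 := by rw [hm p, h', hm q]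
      exact Subtype.ext (Prod.ext (Subtype.ext h') (Subtype.ext (mul_left_cancel₀ p.1.1.2 h1)))
    rw [← hinj.tsum_eq]
    · refine tsum_congr fun p => ?_
      rw [if_pos ⟨_, (hm p).symm⟩]
      have : zetaTerm K s L = zetaTerm K s p.1.1 * zetaTerm K s p.1.2 := by
        simp only [zetaTerm, ← hm p, map_mul, Nat.cast_mul]
        exact Complex.natCast_mul_natCast_cpow _ _ _
      rw [this]
      ring
    · intro I hI
      have hd : I ∣ L.1 := by
        by_contra h
        simp [h] at hI
      obtain ⟨J, hJ⟩ := hd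
      have hne := hJ ▸ L.2
      refine ⟨⟨⟨⟨I, left_ne_zero_of_mul hne⟩, ⟨J, right_ne_zero_of_mul hne⟩⟩, ?_⟩, rfl⟩
      exact Subtype.ext hJ.symm
  rw [tsum_congr key, tsum_eq_single ⟨1, one_ne_zero⟩]
  · simp [zetaTerm]
  · intro L hL
    rw [if_neg (fun h => hL (Subtype.ext h)), mul_zero]

end Moebius

section Residue

variable {K : Type} [Field K] [NumberField K]

lemma tsum_zetaTerm_eq_dedekindZeta {s : ℂ} (hs : 1 < s.re) :
    ∑' I, zetaTerm K s I = dedekindZeta K s := by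
  rw [← ((summable_zetaTerm K hs).hasSum.tsum_fiberwise
    fun I => Ideal.absNorm I.1).tsum_eq, dedekindZeta, LSeries]
  refine tsum_congr fun n => ?_
  have h1 : ∀ I : (fun I : {I : Ideal (𝓞 K) // I ≠ ⊥} => Ideal.absNorm I.1) ⁻¹' {n},
      zetaTerm K s I = (n : ℂ) ^ (-s) := fun I => by
    have : Ideal.absNorm I.1.1 = n := I.2
    rw [zetaTerm, this]
  rw [tsum_congr h1]
  rcases eq_or_ne n 0 with rfl | hn
  · have : IsEmpty ((fun I : {I : Ideal (𝓞 K) // I ≠ ⊥} => Ideal.absNorm I.1) ⁻¹' {0}) :=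
      ⟨fun I => I.1.2 (Ideal.absNorm_eq_zero_iff.1 I.2)⟩
    simp
  · rw [LSeries.term_of_ne_zero hn, tsum_const, nsmul_eq_mul, div_eq_mul_inv, ← Complex.cpow_neg]
    congr 2
    refine Nat.card_congr ⟨fun I => ⟨I.1.1, I.2⟩, fun I => ⟨⟨I.1, ?_⟩, I.2⟩, fun _ => rfl,
      fun _ => rfl⟩
    rintro h
    exact hn (by rw [← I.2, h, Ideal.absNorm_bot])

lemma sub_one_mul_extension_one_ne_zero {Z W : ℂ → ℂ} (hZ : IsDedekindZeta K Z)
    (hW : Differentiable ℂ W) (hWZ : ∀ s ≠ 1, W s = (s - 1) * Z s) : W 1 ≠ 0 := by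
  have h1 : Tendsto (fun s : ℝ => W s) (𝓝[>] 1) (𝓝 (W 1)) := by
    have : ContinuousAt (fun s : ℝ => W s) 1 :=
      (hW.continuous.comp Complex.continuous_ofReal).continuousAt
    simpa [ContinuousAt] using this.tendsto.mono_left nhdsWithin_le_nhds
  have h2 := tendsto_sub_one_mul_dedekindZeta_nhdsGT K
  have h3 : W 1 = dedekindZeta_residue K := by
    refine tendsto_nhds_unique (h1.congr' ?_) h2
    filter_upwards [self_mem_nhdsWithin] with s hs
    have hs' : 1 < (s : ℂ).re := hs
    rw [hWZ _ (fun h => by simp [h] at hs'), hZ.2 _ hs', ← tsum_zetaTerm_eq_dedekindZeta hs']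
    rfl
  rw [h3]
  exact_mod_cast dedekindZeta_residue_ne_zero K

end Residue

section Mellin

/-- The weight `1`, `1 / 2` or `0` with which `n` is counted among the numbers at most `x`. -/
def countWeight (n x : ℝ) : ℝ := if n < x then 1 else if n = x then 1 / 2 else 0

lemma countWeight_nonneg (n x : ℝ) : 0 ≤ countWeight n x := by
  rw [countWeight]
  split_ifs <;> norm_num

lemma countWeight_le_rpow {n x c : ℝ} (hn : 0 < n) (hc : 0 ≤ c) (hx : 0 ≤ x) :
    countWeight n x ≤ (x / n) ^ c := by
  rw [countWeight]
  split_ifs with h1 h2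
  · exact Real.one_le_rpow ((one_le_div hn).2 h1.le) hc
  · rw [h2, div_self (h2 ▸ hn).ne', Real.one_rpow]
    norm_num
  · positivity

lemma measurable_countWeight (n : ℝ) : Measurable (countWeight n) :=
  Measurable.ite measurableSet_Ioi measurable_const
    (Measurable.ite (measurableSet_eq_fun measurable_const measurable_id)
      measurable_const measurable_const)

lemma countWeight_smul_ae_eq {E : Type*} [NormedAddCommGroup E] [NormedSpace ℝ E] (n : ℝ)
    (g : ℝ → E) (s : Set ℝ) :
    (fun x => countWeight n x • g x) =ᵐ[volume.restrict s] (Set.Ioi n).indicator g := by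
  refine ae_restrict_of_ae ?_
  have h : ∀ᵐ x : ℝ, x ≠ n := by simp [ae_iff]
  filter_upwards [h] with x hx
  by_cases hxn : n < x
  · simp [countWeight, hxn]
  · simp [countWeight, hxn, hx.symm]

lemma integrableOn_countWeight_smul {E : Type*} [NormedAddCommGroup E] [NormedSpace ℝ E] {n : ℝ}
    {g : ℝ → E} (hg : IntegrableOn g (Set.Ioi n)) (s : Set ℝ) :
    IntegrableOn (fun x => countWeight n x • g x) s := by
  rw [IntegrableOn, integrable_congr (countWeight_smul_ae_eq n g s)]
  exact (hg.integrable_indicator measurableSet_Ioi).integrableOn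

lemma setIntegral_countWeight_smul {E : Type*} [NormedAddCommGroup E] [NormedSpace ℝ E] {n a : ℝ}
    (h : a ≤ n) (g : ℝ → E) :
    ∫ x in Set.Ioi a, countWeight n x • g x = ∫ x in Set.Ioi n, g x := by
  rw [integral_congr_ae (countWeight_smul_ae_eq n g _), setIntegral_indicator measurableSet_Ioi,
    Set.Ioi_inter_Ioi, max_eq_right h]

/-- The sum of the `a i` over the indices with `N i ≤ x`, those with `N i = x` counting half. -/
def summatory {ι : Type*} (a N : ι → ℝ) (x : ℝ) : ℝ := ∑' i, a i * countWeight (N i) x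

variable {ι : Type*} {a N : ι → ℝ}

lemma norm_mul_countWeight_le {c x : ℝ} (ha : ∀ i, |a i| ≤ 1) (hN : ∀ i, 1 ≤ N i) (hc : 0 ≤ c)
    (hx : 0 ≤ x) (i : ι) : ‖a i * countWeight (N i) x‖ ≤ x ^ c * N i ^ (-c) := by
  have hi : 0 < N i := one_pos.trans_le (hN i)
  rw [norm_mul, Real.norm_eq_abs, Real.norm_eq_abs, abs_of_nonneg (countWeight_nonneg _ _),
    Real.rpow_neg hi.le, ← div_eq_mul_inv, ← Real.div_rpow hx hi.le]
  exact (mul_le_of_le_one_left (countWeight_nonneg _ _) (ha i)).trans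
    (countWeight_le_rpow hi hc hx)

lemma abs_summatory_le {c x : ℝ} (ha : ∀ i, |a i| ≤ 1) (hN : ∀ i, 1 ≤ N i) (hc : 0 ≤ c)
    (hx : 0 ≤ x) (hsum : Summable fun i => N i ^ (-c)) :
    |summatory a N x| ≤ (∑' i, N i ^ (-c)) * x ^ c := by
  rw [mul_comm, ← tsum_mul_left, ← Real.norm_eq_abs]
  exact tsum_of_norm_bounded (hsum.mul_left _).hasSum (norm_mul_countWeight_le ha hN hc hx)

variable [Countable ι]

lemma measurable_summatory : Measurable (summatory a N) :=
  Measurable.tsum fun i => (measurable_countWeight (N i)).const_mul (a i)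

lemma integral_summatory_mul_cpow (ha : ∀ i, |a i| ≤ 1) (hN : ∀ i, 1 ≤ N i)
    {s : ℂ} (hs : 0 < s.re) (hsum : Summable fun i => N i ^ (-s.re)) :
    ∫ x : ℝ in Set.Ioi 1, (summatory a N x : ℂ) * (x : ℂ) ^ (-s - 1) =
      (∑' i, (a i : ℂ) * (N i : ℂ) ^ (-s)) / s := by
  have hN0 : ∀ i, 0 < N i := fun i => one_pos.trans_le (hN i)
  have hre : (-s - 1).re < -1 := by
    simp only [Complex.sub_re, Complex.neg_re, Complex.one_re]
    linarith
  have hs0 : s ≠ 0 := fun h => by simp [h] at hs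
  have h_integ : ∀ i, IntegrableOn (fun x : ℝ => (a i : ℂ) * (x : ℂ) ^ (-s - 1)) (Set.Ioi (N i)) :=
    fun i => (integrableOn_Ioi_cpow_of_lt hre (hN0 i)).const_mul _
  have hnorm : ∀ i, ∫ x : ℝ in Set.Ioi 1, ‖countWeight (N i) x • ((a i : ℂ) * (x : ℂ) ^ (-s - 1))‖ =
      |a i| * (N i ^ (-s.re) / s.re) := by
    intro i
    have : ∀ x : ℝ, ‖countWeight (N i) x • ((a i : ℂ) * (x : ℂ) ^ (-s - 1))‖ =
        countWeight (N i) x • ‖(a i : ℂ) * (x : ℂ) ^ (-s - 1)‖ := fun x => by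
      rw [norm_smul, Real.norm_eq_abs, abs_of_nonneg (countWeight_nonneg _ _), smul_eq_mul]
    simp_rw [this]
    rw [setIntegral_countWeight_smul (hN i)]
    have h2 : ∀ x ∈ Set.Ioi (N i), ‖(a i : ℂ) * (x : ℂ) ^ (-s - 1)‖ =
        |a i| * x ^ (-s.re - 1) := fun x hx => by
      rw [norm_mul, Complex.norm_real, Real.norm_eq_abs,
        Complex.norm_cpow_eq_rpow_re_of_pos ((hN0 i).trans hx)]
      simp
    rw [setIntegral_congr_fun measurableSet_Ioi h2, integral_const_mul,
      integral_Ioi_rpow_of_lt (by linarith) (hN0 i), sub_add_cancel, neg_div_neg_eq]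
  have hS : Summable fun i => ∫ x : ℝ in Set.Ioi 1,
      ‖countWeight (N i) x • ((a i : ℂ) * (x : ℂ) ^ (-s - 1))‖ := by
    simp_rw [hnorm]
    refine (hsum.div_const s.re).of_nonneg_of_le (fun i => ?_) fun i => ?_
    · have := hN0 i
      positivity
    · have := hN0 i
      exact mul_le_of_le_one_left (by positivity) (ha i)
  have key := (hasSum_integral_of_summable_integral_norm
    (fun i => integrableOn_countWeight_smul (h_integ i) (Set.Ioi 1)) hS).tsum_eq
  rw [← tsum_div_const]
  calc _ = ∫ x : ℝ in Set.Ioi 1, ∑' i, countWeight (N i) x • ((a i : ℂ) * (x : ℂ) ^ (-s - 1)) := by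
        congr 1 with x
        rw [summatory, Complex.ofReal_tsum, ← tsum_mul_right]
        refine tsum_congr fun i => ?_
        rw [Complex.real_smul, Complex.ofReal_mul]
        ring
    _ = _ := by
        rw [← key]
        refine tsum_congr fun i => ?_
        rw [setIntegral_countWeight_smul (hN i), integral_const_mul,
          integral_Ioi_cpow_of_lt hre (hN0 i), sub_add_cancel, neg_div_neg_eq, mul_div_assoc]

end Mellin

section Mertens

variable (K : Type) [Field K] [NumberField K]

instance countable_nonzero_ideal : Countable {I : Ideal (𝓞 K) // I ≠ ⊥} := by
  have h := (summable_zetaTerm K (s := 2) (by norm_num)).countable_support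
  have h2 : Function.support (zetaTerm K 2) = Set.univ := by
    refine Set.eq_univ_of_forall fun I => ?_
    have : (Ideal.absNorm I.1 : ℂ) ≠ 0 := by
      exact_mod_cast fun h => I.2 (Ideal.absNorm_eq_zero_iff.1 h)
    simp [zetaTerm, this, Complex.cpow_eq_zero_iff]
  rw [h2] at h
  exact Set.countable_univ_iff.1 h

variable {K}

lemma mertensK_eq_summatory : mertensK K = summatory
    (fun I : {I : Ideal (𝓞 K) // I ≠ ⊥} => (moebiusK K I.1 : ℝ))
    (fun I => (Ideal.absNorm I.1 : ℝ)) := by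
  ext x
  rw [mertensK, summatory, ← Subtype.val_injective.tsum_eq (g := fun I :
    {I : Ideal (𝓞 K) // I ≠ ⊥} => I.1)]
  · refine tsum_congr fun I => ?_
    simp only [I.2, true_and, countWeight, ne_eq, not_false_eq_true, mul_ite, mul_one, mul_zero]
    split_ifs <;> ring
  · intro I hI
    refine ⟨⟨I, ?_⟩, rfl⟩
    rintro (rfl : I = ⊥)
    simp at hI

lemma one_le_absNorm (I : {I : Ideal (𝓞 K) // I ≠ ⊥}) : (1 : ℝ) ≤ Ideal.absNorm I.1 := by
  exact_mod_cast Nat.one_le_iff_ne_zero.2 fun h => I.2 (Ideal.absNorm_eq_zero_iff.1 h)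

lemma summable_absNorm_rpow {c : ℝ} (hc : 1 < c) :
    Summable fun I : {I : Ideal (𝓞 K) // I ≠ ⊥} => (Ideal.absNorm I.1 : ℝ) ^ (-c) := by
  refine (summable_zetaTerm K (s := c) (by simpa using hc)).norm.congr fun I => ?_
  have : (0 : ℝ) < Ideal.absNorm I.1 := one_pos.trans_le (one_le_absNorm I)
  rw [zetaTerm, ← Complex.ofReal_natCast, Complex.norm_cpow_eq_rpow_re_of_pos this]
  simp

lemma measurable_mertensK : Measurable (mertensK K) := by
  rw [mertensK_eq_summatory]
  exact measurable_summatory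

lemma exists_abs_mertensK_le {c : ℝ} (hc : 1 < c) :
    ∃ A : ℝ, 0 ≤ A ∧ ∀ x : ℝ, 0 ≤ x → |mertensK K x| ≤ A * x ^ c := by
  refine ⟨∑' I : {I : Ideal (𝓞 K) // I ≠ ⊥}, (Ideal.absNorm I.1 : ℝ) ^ (-c),
    tsum_nonneg fun I => by positivity, fun x hx => ?_⟩
  rw [mertensK_eq_summatory]
  exact abs_summatory_le (fun I => abs_moebiusK_le_one I.1) one_le_absNorm (by linarith) hx
    (summable_absNorm_rpow hc)

lemma integral_mertensK_mul_cpow {Z : ℂ → ℂ} (hZ : IsDedekindZeta K Z) {s : ℂ} (hs : 1 < s.re) :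
    (∫ x : ℝ in Set.Ioi 1, (mertensK K x : ℂ) * (x : ℂ) ^ (-s - 1)) * s * Z s = 1 := by
  have hs0 : s ≠ 0 := fun h => by simp [h] at hs; linarith
  rw [mertensK_eq_summatory, integral_summatory_mul_cpow (fun I => abs_moebiusK_le_one I.1)
    one_le_absNorm (by linarith) (summable_absNorm_rpow hs), div_mul_cancel₀ _ hs0, hZ.2 s hs,
    ← tsum_moebiusK_mul_tsum_zetaTerm (K := K) hs]
  simp [zetaTerm]

end Mertens

section Landau

open ProbabilityTheory

variable {Ω : Type*} {m : MeasurableSpace Ω} {X : Ω → ℝ} {ν : Measure Ω}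

/-- Landau's lemma: the moment generating function of a nonnegative function is integrable
beyond any real point to which it extends holomorphically. -/
lemma exists_gt_mem_integrableExpSet (hX : AEMeasurable X ν) (hX0 : ∀ᵐ ω ∂ν, 0 ≤ X ω) {t₀ δ : ℝ}
    (hδ : 0 < δ) (hS : Set.Iio t₀ ⊆ integrableExpSet X ν) {g : ℂ → ℂ}
    (hg : DifferentiableOn ℂ g (Metric.ball (t₀ : ℂ) δ))
    (heq : ∀ z ∈ Metric.ball (t₀ : ℂ) δ, z.re < t₀ → complexMGF X ν z = g z) :
    ∃ t, t₀ < t ∧ t ∈ integrableExpSet X ν := by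
  set a : ℝ := t₀ - δ / 4 with ha
  have hsub : Metric.ball (a : ℂ) (3 * δ / 4) ⊆ Metric.ball (t₀ : ℂ) δ := by
    refine Metric.ball_subset_ball' ?_
    rw [Complex.dist_of_im_eq (by simp)]
    simp only [Complex.ofReal_re, Real.dist_eq, ha]
    rw [sub_sub_cancel_left, abs_neg, abs_of_pos (by positivity)]
    linarith
  have hain : a ∈ interior (integrableExpSet X ν) :=
    interior_mono hS (by rw [isOpen_Iio.interior_eq, Set.mem_Iio]; linarith)
  have hder : ∀ n : ℕ, iteratedDeriv n g a = ((∫ ω, X ω ^ n * Real.exp (a * X ω) ∂ν : ℝ) : ℂ) := by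
    intro n
    have h1 : g =ᶠ[𝓝 (a : ℂ)] complexMGF X ν := by
      have h2 : ∀ᶠ z : ℂ in 𝓝 (a : ℂ), z.re < t₀ :=
        (isOpen_lt Complex.continuous_re continuous_const).mem_nhds
          (by simp only [Set.mem_ofPred_eq, Complex.ofReal_re]; linarith)
      filter_upwards [Metric.ball_mem_nhds (a : ℂ) (show 0 < 3 * δ / 4 by positivity), h2]
        with z hz hz' using (heq z (hsub hz) hz').symm
    rw [h1.iteratedDeriv_eq, iteratedDeriv_complexMGF (by simpa using hain),
      ← integral_complex_ofReal]
    congr 1 with ω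
    push_cast
    rfl
  set t : ℝ := t₀ + δ / 8 with ht
  have hta : t - a = 3 * δ / 8 := by rw [ha, ht]; ring
  have hmem : (t : ℂ) ∈ Metric.ball (a : ℂ) (3 * δ / 4) := by
    rw [Metric.mem_ball, Complex.dist_of_im_eq (by simp)]
    simp only [Complex.ofReal_re, Real.dist_eq]
    rw [hta, abs_of_pos (by positivity)]
    linarith
  have hsum := (Complex.hasSum_taylorSeries_on_ball (hg.mono hsub) hmem).summable
  set F : ℕ → Ω → ℝ := fun n ω => ((n.factorial : ℝ)⁻¹ * (t - a) ^ n) *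
    (X ω ^ n * Real.exp (a * X ω)) with hF
  have hFint : ∀ n, Integrable (F n) ν := fun n =>
    (integrable_pow_mul_exp_of_mem_interior_integrableExpSet hain n).const_mul _
  have hF0 : ∀ᵐ ω ∂ν, ∀ n, 0 ≤ F n ω := by
    filter_upwards [hX0] with ω hω n
    have : 0 ≤ t - a := by rw [hta]; positivity
    positivity
  have hsumF : Summable fun n => ∫ ω, F n ω ∂ν := by
    rw [← Complex.summable_ofReal]
    refine hsum.congr fun n => ?_
    rw [hder n]
    simp only [hF, integral_const_mul, smul_eq_mul]
    push_cast
    ring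
  have hexp : ∀ ω, HasSum (fun n => F n ω) (Real.exp (t * X ω)) := by
    intro ω
    have h1 := (NormedSpace.expSeries_div_hasSum_exp ((t - a) * X ω)).mul_right
      (Real.exp (a * X ω))
    rw [← Real.exp_eq_exp_ℝ, ← Real.exp_add, ← add_mul, sub_add_cancel] at h1
    refine h1.congr_fun fun n => ?_
    rw [hF, mul_pow]
    ring
  refine ⟨t, by rw [ht]; linarith, ?_⟩
  refine ⟨(Real.measurable_exp.comp_aemeasurable (hX.const_mul t)).aestronglyMeasurable, ?_⟩
  rw [hasFiniteIntegral_iff_ofReal (ae_of_all _ fun ω => (Real.exp_pos _).le)]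
  calc ∫⁻ ω, ENNReal.ofReal (Real.exp (t * X ω)) ∂ν
      = ∫⁻ ω, ∑' n, ENNReal.ofReal (F n ω) ∂ν := by
        refine lintegral_congr_ae ?_
        filter_upwards [hF0] with ω hω
        rw [← ENNReal.ofReal_tsum_of_nonneg hω (hexp ω).summable, (hexp ω).tsum_eq]
    _ = ∑' n, ENNReal.ofReal (∫ ω, F n ω ∂ν) := by
        rw [lintegral_tsum fun n => (hFint n).aestronglyMeasurable.aemeasurable.ennreal_ofReal]
        refine tsum_congr fun n => ?_
        rw [ofReal_integral_eq_lintegral_ofReal (hFint n)]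
        filter_upwards [hF0] with ω hω using hω n
    _ < ⊤ := by
        rw [← ENNReal.ofReal_tsum_of_nonneg _ hsumF]
        · exact ENNReal.ofReal_lt_top
        · intro n
          refine integral_nonneg_of_ae ?_
          filter_upwards [hF0] with ω hω using hω n

/-- An identity `F * Q = P` for the moment generating function `F` of a nonnegative function
extends, along with the half-plane of integrability, up to the first real zero of `Q`. -/
lemma complexMGF_mul_eq_of_ne_zero (hX : AEMeasurable X ν) (hX0 : ∀ᵐ ω ∂ν, 0 ≤ X ω) {t₁ t₂ : ℝ}
    (hS : Set.Iio t₁ ⊆ integrableExpSet X ν) {P Q : ℂ → ℂ} (hP : Differentiable ℂ P)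
    (hQ : Differentiable ℂ Q) (hQ0 : ∀ t : ℝ, t₁ ≤ t → t < t₂ → Q t ≠ 0)
    (heq : ∀ z : ℂ, z.re < t₁ → complexMGF X ν z * Q z = P z) {z : ℂ} (hz : z.re < t₂) :
    complexMGF X ν z * Q z = P z := by
  have hext : ∀ T : ℝ, Set.Iio T ⊆ integrableExpSet X ν → ∀ z : ℂ, z.re < T →
      complexMGF X ν z * Q z = P z := by
    intro T hT z hz
    have hU : IsOpen {z : ℂ | z.re < T} := isOpen_lt Complex.continuous_re continuous_const
    have hL : DifferentiableOn ℂ (fun z => complexMGF X ν z * Q z) {z : ℂ | z.re < T} := by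
      refine (differentiableOn_complexMGF.mono fun z hz => ?_).mul hQ.differentiableOn
      exact interior_mono hT (by rwa [isOpen_Iio.interior_eq])
    have hconv : IsPreconnected {z : ℂ | z.re < T} := (convex_halfSpace_re_lt T).isPreconnected
    set w : ℂ := ((min T t₁ - 1 : ℝ) : ℂ) with hw
    have hwre : w.re = min T t₁ - 1 := Complex.ofReal_re _
    have hwT : w.re < T := by have := min_le_left T t₁; linarith
    have hwt : w.re < t₁ := by have := min_le_right T t₁; linarith
    refine (hL.analyticOnNhd hU).eqOn_of_preconnected_of_eventuallyEq
      (hP.differentiableOn.analyticOnNhd hU) hconv (z₀ := w) hwT ?_ hz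
    filter_upwards [(isOpen_lt Complex.continuous_re continuous_const).mem_nhds hwt] with u hu
      using heq u hu
  refine hext t₂ ?_ z hz
  by_contra hcon
  obtain ⟨t', ht', ht'S⟩ := Set.not_subset.1 hcon
  have hord : (integrableExpSet X ν).OrdConnected := convex_integrableExpSet.ordConnected
  have hdown : ∀ t ∈ integrableExpSet X ν, ∀ u < t, u ∈ integrableExpSet X ν := by
    intro t ht u hu
    have h1 : min u t₁ - 1 ∈ integrableExpSet X ν :=
      hS (by rw [Set.mem_Iio]; have := min_le_right u t₁; linarith)
    exact hord.out h1 ht ⟨by have := min_le_left u t₁; linarith, hu.le⟩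
  have hbd : ∀ t ∈ integrableExpSet X ν, t ≤ t' := fun t ht => by
    by_contra! h
    exact ht'S (hdown t ht t' h)
  have hbdd : BddAbove (integrableExpSet X ν) := ⟨t', hbd⟩
  have hne : (integrableExpSet X ν).Nonempty := ⟨t₁ - 1, hS (by rw [Set.mem_Iio]; linarith)⟩
  set t₀ := sSup (integrableExpSet X ν) with ht₀
  have h₀ : Set.Iio t₀ ⊆ integrableExpSet X ν := fun u hu => by
    obtain ⟨t, ht, hut⟩ := exists_lt_of_lt_csSup hne hu
    exact hdown t ht u hut
  have h₁ : t₁ ≤ t₀ := le_of_forall_lt fun u hu => by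
    obtain ⟨v, huv, hv⟩ := exists_between hu
    exact huv.trans_le (le_csSup hbdd (hS hv))
  have h₂ : t₀ < t₂ := (csSup_le hne hbd).trans_lt ht'
  have hQt := hQ0 t₀ h₁ h₂
  obtain ⟨δ, hδ, hball⟩ := Metric.eventually_nhds_iff_ball.1
    (hQ.continuous.continuousAt.eventually_ne hQt)
  obtain ⟨t, ht, htS⟩ := exists_gt_mem_integrableExpSet hX hX0 hδ h₀ (g := fun z => P z / Q z)
    (hP.differentiableOn.div hQ.differentiableOn hball) fun z hz hz' => by
      rw [eq_div_iff (hball z hz), hext t₀ h₀ z hz']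
  exact absurd (le_csSup hbdd htS) (not_le.2 ht)

end Landau

section Oscillation

open ProbabilityTheory

/-- The measure `f x / x dx` on `(1, ∞)`, whose moment generating function along `log` is the
Mellin transform of `f`. -/
def mellinMeasure (f : ℝ → ℝ) : Measure ℝ :=
  (volume.restrict (Set.Ioi 1)).withDensity fun x => ENNReal.ofReal (f x / x)

lemma ae_log_nonneg_mellinMeasure (f : ℝ → ℝ) : ∀ᵐ x ∂mellinMeasure f, 0 ≤ Real.log x := by
  refine (withDensity_absolutelyContinuous _ _).ae_le ?_
  filter_upwards [ae_restrict_mem measurableSet_Ioi] with x hx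
  exact Real.log_nonneg (le_of_lt hx)

lemma complexMGF_mellinMeasure {f : ℝ → ℝ} (hf : Measurable f) (hf0 : ∀ x, 1 < x → 0 ≤ f x)
    (z : ℂ) : complexMGF Real.log (mellinMeasure f) z =
      ∫ x : ℝ in Set.Ioi 1, (f x : ℂ) * (x : ℂ) ^ (z - 1) := by
  have hd : Measurable fun x => ENNReal.ofReal (f x / x) := (hf.div measurable_id).ennreal_ofReal
  rw [complexMGF, mellinMeasure, integral_withDensity_eq_integral_toReal_smul hd
    (ae_of_all _ fun _ => ENNReal.ofReal_lt_top)]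
  refine setIntegral_congr_fun measurableSet_Ioi fun x hx => ?_
  have hx0 : 0 < x := one_pos.trans hx
  have hxc : (x : ℂ) ≠ 0 := by exact_mod_cast hx0.ne'
  rw [ENNReal.toReal_ofReal (div_nonneg (hf0 x hx) hx0.le), Complex.real_smul,
    Complex.cpow_sub _ _ hxc, Complex.cpow_one, Complex.cpow_def_of_ne_zero hxc,
    ← Complex.ofReal_log hx0.le, mul_comm z]
  push_cast
  ring

lemma mem_integrableExpSet_mellinMeasure {f : ℝ → ℝ} (hf : Measurable f)
    (hf0 : ∀ x, 1 < x → 0 ≤ f x) {t : ℝ}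
    (h : IntegrableOn (fun x : ℝ => (f x : ℂ) * (x : ℂ) ^ ((t : ℂ) - 1)) (Set.Ioi 1)) :
    t ∈ integrableExpSet Real.log (mellinMeasure f) := by
  have h1 : IntegrableOn (fun x : ℝ => ‖(f x : ℂ) * (x : ℂ) ^ ((t : ℂ) - 1)‖) (Set.Ioi 1) :=
    h.norm
  have hd : Measurable fun x => ENNReal.ofReal (f x / x) := (hf.div measurable_id).ennreal_ofReal
  rw [integrableExpSet, Set.mem_ofPred_eq, mellinMeasure,
    integrable_withDensity_iff hd (ae_of_all _ fun _ => ENNReal.ofReal_lt_top)]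
  refine h1.congr_fun (fun x hx => ?_) measurableSet_Ioi
  have hx0 : 0 < x := one_pos.trans hx
  simp only
  rw [ENNReal.toReal_ofReal (div_nonneg (hf0 x hx) hx0.le), norm_mul, Complex.norm_real,
    Real.norm_of_nonneg (hf0 x hx), Complex.norm_cpow_eq_rpow_re_of_pos hx0, Complex.sub_re,
    Complex.ofReal_re, Complex.one_re, Real.rpow_sub hx0, Real.rpow_one, mul_comm t,
    ← Real.rpow_def_of_pos hx0]
  ring

variable {K : Type} [Field K] [NumberField K]

lemma integrableOn_mertensK_mul_cpow {z : ℂ} (hz : z.re < -1) :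
    IntegrableOn (fun x : ℝ => (mertensK K x : ℂ) * (x : ℂ) ^ (z - 1)) (Set.Ioi 1) := by
  obtain ⟨c, hc1, hcz⟩ := exists_between (show 1 < -z.re by linarith)
  obtain ⟨A, -, hM⟩ := exists_abs_mertensK_le (K := K) hc1
  refine Integrable.mono' ((integrableOn_Ioi_rpow_of_lt
    (show c + (z.re - 1) < -1 by linarith) one_pos).const_mul A) ?_ ?_
  · refine Measurable.aestronglyMeasurable ?_
    exact (Complex.measurable_ofReal.comp measurable_mertensK).mul
      (Complex.measurable_ofReal.pow_const _)
  · filter_upwards [ae_restrict_mem measurableSet_Ioi] with x hx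
    have hx0 : 0 < x := one_pos.trans hx
    rw [norm_mul, Complex.norm_real, Real.norm_eq_abs,
      Complex.norm_cpow_eq_rpow_re_of_pos hx0, Complex.sub_re, Complex.one_re, Real.rpow_add hx0,
      ← mul_assoc]
    exact mul_le_mul_of_nonneg_right (hM x hx0.le) (by positivity)

/-- A one-sided bound `e * M_K(x) ≤ C * x ^ θ` excludes zeros of `ζ_K` to the right of `θ`, unless
there is a real one. -/
lemma not_eventually_mul_mertensK_le {Z : ℂ → ℂ} (hZ : IsDedekindZeta K Z) {e θ C : ℝ}
    (he : e ≠ 0) (hθ : 0 ≤ θ) (hreal : ∀ x : ℝ, θ < x → x < 1 → Z x ≠ 0) {ρ : ℂ} (hρ : Z ρ = 0)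
    (hρθ : θ < ρ.re) (hρ1 : ρ.re < 1) :
    ¬ ∀ᶠ x in atTop, e * mertensK K x ≤ C * x ^ θ := by
  intro hev
  obtain ⟨W, hW, hWZ⟩ := exists_differentiable_eq_sub_one_mul hZ
  have hW1 := sub_one_mul_extension_one_ne_zero hZ hW hWZ
  obtain ⟨A, hA, hM⟩ := exists_abs_mertensK_le (K := K) one_lt_two
  obtain ⟨x₀, hx₀⟩ := eventually_atTop.1 hev
  set y := max x₀ 1 with hy
  have hy1 : 1 ≤ y := le_max_right _ _
  set B : ℝ := max C (|e| * (A * y ^ (2 : ℝ))) with hB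
  set f : ℝ → ℝ := fun x => B * x ^ θ - e * mertensK K x with hf
  have hfm : Measurable f :=
    ((measurable_id.pow_const θ).const_mul B).sub (measurable_mertensK.const_mul e)
  have hf0 : ∀ x, 1 < x → 0 ≤ f x := by
    intro x hx
    have hx0 : 0 < x := one_pos.trans hx
    have hxθ : 1 ≤ x ^ θ := Real.one_le_rpow hx.le hθ
    rw [hf, sub_nonneg]
    rcases le_or_gt y x with h | h
    · exact (hx₀ x ((le_max_left _ _).trans h)).trans
        (mul_le_mul_of_nonneg_right (le_max_left _ _) (by positivity))
    · calc e * mertensK K x ≤ |e| * |mertensK K x| := by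
            rw [← abs_mul]
            exact le_abs_self _
        _ ≤ |e| * (A * y ^ (2 : ℝ)) := by
            refine mul_le_mul_of_nonneg_left ((hM x hx0.le).trans ?_) (abs_nonneg e)
            exact mul_le_mul_of_nonneg_left (Real.rpow_le_rpow hx0.le h.le (by norm_num)) hA
        _ ≤ B := le_max_right _ _
        _ ≤ B * x ^ θ := by
            refine le_mul_of_one_le_right ?_ hxθ
            exact le_trans (by positivity) (le_max_right C (|e| * (A * y ^ (2 : ℝ))))
  have hθ1 : θ < 1 := hρθ.trans hρ1
  have hpow : ∀ z : ℂ, z.re < -1 →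
      IntegrableOn (fun x : ℝ => (x : ℂ) ^ ((θ : ℂ) + z - 1)) (Set.Ioi 1) := fun z hz =>
    integrableOn_Ioi_cpow_of_lt (by simp; linarith) one_pos
  have hsplit : ∀ z : ℂ, ∀ x ∈ Set.Ioi (1 : ℝ), (f x : ℂ) * (x : ℂ) ^ (z - 1) =
      B * (x : ℂ) ^ ((θ : ℂ) + z - 1) - e * ((mertensK K x : ℂ) * (x : ℂ) ^ (z - 1)) := by
    intro z x hx
    have hx0 : 0 < x := one_pos.trans hx
    rw [add_sub_assoc, Complex.cpow_add _ _ (by exact_mod_cast hx0.ne'),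
      ← Complex.ofReal_cpow hx0.le]
    simp only [hf]
    push_cast
    ring
  have hfint : ∀ z : ℂ, z.re < -1 →
      IntegrableOn (fun x : ℝ => (f x : ℂ) * (x : ℂ) ^ (z - 1)) (Set.Ioi 1) := fun z hz =>
    IntegrableOn.congr_fun (((hpow z hz).const_mul (B : ℂ)).sub
      ((integrableOn_mertensK_mul_cpow hz).const_mul (e : ℂ)))
      (fun x hx => (hsplit z x hx).symm) measurableSet_Ioi
  have hS : Set.Iio (-1) ⊆ integrableExpSet Real.log (mellinMeasure f) := fun t ht =>
    mem_integrableExpSet_mellinMeasure hfm hf0 (hfint t (by simpa using ht))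
  set Q : ℂ → ℂ := fun z => -z * (-z - θ) * W (-z) with hQ
  set P : ℂ → ℂ := fun z => B * -z * W (-z) - e * ((-z - θ) * (-z - 1)) with hP
  have hid : ∀ z : ℂ, z.re < -1 →
      complexMGF Real.log (mellinMeasure f) z * Q z = P z := by
    intro z hz
    have hs : 1 < (-z).re := by rw [Complex.neg_re]; linarith
    have hne : -z ≠ 1 := fun h => by simp [h] at hs
    have hθz : (θ : ℂ) + z ≠ 0 := fun h => by
      have := congrArg Complex.re h
      simp at this
      linarith
    have hmz := integral_mertensK_mul_cpow hZ hs
    rw [neg_neg] at hmz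
    rw [complexMGF_mellinMeasure hfm hf0, setIntegral_congr_fun measurableSet_Ioi (hsplit z),
      integral_sub ((hpow z hz).const_mul _) ((integrableOn_mertensK_mul_cpow hz).const_mul _),
      integral_const_mul, integral_const_mul,
      integral_Ioi_cpow_of_lt (by simp; linarith) one_pos, sub_add_cancel, Complex.ofReal_one,
      Complex.one_cpow]
    simp only [hQ, hP, hWZ _ hne]
    set I := ∫ x : ℝ in Set.Ioi 1, (mertensK K x : ℂ) * (x : ℂ) ^ (z - 1)
    have h1 : (-1 : ℂ) / (θ + z) * (-z - θ) = 1 := by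
      rw [div_mul_eq_mul_div, div_eq_one_iff_eq hθz]
      ring
    linear_combination (B * -z * ((-z - 1) * Z (-z))) * h1 - e * ((-z - θ) * (-z - 1)) * hmz
  have hQ0 : ∀ t : ℝ, -1 ≤ t → t < -θ → Q t ≠ 0 := by
    intro t ht ht'
    have h1 : (-t : ℂ) ≠ 0 := by
      rw [neg_ne_zero]
      exact_mod_cast (by linarith : t < 0).ne
    have h2 : (-t - θ : ℂ) ≠ 0 := by
      exact_mod_cast (by linarith : 0 < -t - θ).ne'
    refine mul_ne_zero (mul_ne_zero h1 h2) ?_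
    rcases ht.eq_or_lt with rfl | h
    · simpa using hW1
    · have h3 : (-t : ℂ) ≠ 1 := by exact_mod_cast (by linarith : -t < 1).ne
      rw [hWZ _ h3]
      refine mul_ne_zero (sub_ne_zero.2 h3) ?_
      have := hreal (-t) (by linarith) (by linarith)
      rwa [Complex.ofReal_neg] at this
  have hQd : Differentiable ℂ Q := by
    have := hW.comp differentiable_neg
    exact (differentiable_neg.mul (differentiable_neg.sub_const _)).mul this
  have hPd : Differentiable ℂ P := by
    have := hW.comp differentiable_neg
    exact (((differentiable_const _).mul differentiable_neg).mul this).sub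
      ((differentiable_const _).mul
        ((differentiable_neg.sub_const _).mul (differentiable_neg.sub_const _)))
  have key := complexMGF_mul_eq_of_ne_zero Real.measurable_log.aemeasurable
    (ae_log_nonneg_mellinMeasure f) hS hPd hQd hQ0 hid (z := -ρ)
    (by rw [Complex.neg_re]; linarith)
  have hρne : ρ ≠ 1 := fun h => by simp [h] at hρ1
  have hWρ : W ρ = 0 := by rw [hWZ _ hρne, hρ, mul_zero]
  simp only [hQ, hP, neg_neg, hWρ, mul_zero, zero_sub] at key
  have hρθ' : ρ - θ ≠ 0 := fun h => by
    have := congrArg Complex.re h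
    simp at this
    linarith
  have heC : (e : ℂ) ≠ 0 := by exact_mod_cast he
  exact neg_ne_zero.2 (mul_ne_zero heC (mul_ne_zero hρθ' (sub_ne_zero.2 hρne))) key.symm

lemma not_eventually_mul_mertensK_le_of_isLUB {Z : ℂ → ℂ} (hZ : IsDedekindZeta K Z) {Θ Θ' : ℝ}
    (hΘ : IsLUB {x : ℝ | ∃ ρ : ℂ, Z ρ = 0 ∧ 0 < ρ.re ∧ ρ.re < 1 ∧ ρ.re = x} Θ)
    (hΘ' : IsLUB (insert (0 : ℝ) {x : ℝ | 0 < x ∧ x < 1 ∧ Z (x : ℂ) = 0}) Θ')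
    {e θ : ℝ} (C : ℝ) (he : e ≠ 0) (h1 : Θ' < θ) (h2 : θ < Θ) :
    ¬ ∀ᶠ x in atTop, e * mertensK K x ≤ C * x ^ θ := by
  have hθ0 : 0 < θ := (hΘ'.1 (Set.mem_insert _ _)).trans_lt h1
  obtain ⟨_, ⟨ρ, hρ, -, hρ1, rfl⟩, hρθ, -⟩ := hΘ.exists_between h2
  refine not_eventually_mul_mertensK_le hZ he hθ0.le (fun x hx hx1 h0 => ?_) hρ hρθ hρ1
  exact absurd (hΘ'.1 (Set.mem_insert_of_mem _ ⟨hθ0.trans hx, hx1, h0⟩)) (not_le.2 (h1.trans hx))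

end Oscillation

/-- **Proposition 2.7.** Suppose `ζ_K` does not satisfy the Riemann hypothesis
(`Θ > 1/2`) and that `Θ' < Θ` (the supremum `Θ` of real parts of nontrivial zeros is not
attained among the real zeros). Then `M_K(x) = Ω_±(x^{Θ-ε})` for all `0 < ε < Θ - Θ'`;
in particular the naïve Mertens-type conjecture over `K` is false. -/
theorem omega_pm_no_RH_rightmost_not_real
    (K : Type) [Field K] [NumberField K]
    (Z : ℂ → ℂ) (hZ : IsDedekindZeta K Z)
    (Θ Θ' : ℝ)
    (hΘ : IsLUB {x : ℝ | ∃ ρ : ℂ, Z ρ = 0 ∧ 0 < ρ.re ∧ ρ.re < 1 ∧ ρ.re = x} Θ)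
    (hΘ' : IsLUB (insert (0 : ℝ) {x : ℝ | 0 < x ∧ x < 1 ∧ Z (x : ℂ) = 0}) Θ')
    (hnoRH : 1 / 2 < Θ) (hlt : Θ' < Θ) :
    (∀ ε : ℝ, 0 < ε → ε < Θ - Θ' →
      (0 : EReal) < Filter.limsup
          (fun x : ℝ => ((mertensK K x / x ^ (Θ - ε) : ℝ) : EReal)) Filter.atTop ∧
      Filter.liminf
          (fun x : ℝ => ((mertensK K x / x ^ (Θ - ε) : ℝ) : EReal)) Filter.atTop
        < (0 : EReal)) ∧
    ¬ NaiveMertensConj K := by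
  have hlow : ∀ ε : ℝ, 0 < ε → ε < Θ - Θ' → ∀ e : ℝ, e ≠ 0 →
      ¬ ∀ᶠ x in atTop, e * mertensK K x ≤ 1 * x ^ (Θ - ε) := fun ε h0 h1 e he =>
    not_eventually_mul_mertensK_le_of_isLUB hZ hΘ hΘ' 1 he (by linarith) (by linarith)
  refine ⟨fun ε h0 h1 => ⟨?_, ?_⟩, fun hconj => ?_⟩
  · by_contra! hcon
    refine hlow ε h0 h1 1 one_ne_zero ?_
    filter_upwards [eventually_lt_of_limsup_lt (hcon.trans_lt zero_lt_one), eventually_gt_atTop 0]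
      with x hx hx0
    have hx' : mertensK K x / x ^ (Θ - ε) < 1 := by exact_mod_cast hx
    rw [div_lt_one (Real.rpow_pos_of_pos hx0 _)] at hx'
    linarith
  · by_contra! hcon
    refine hlow ε h0 h1 (-1) (by norm_num) ?_
    have hneg : ((-1 : ℝ) : EReal) < 0 := by exact_mod_cast neg_one_lt_zero (R := ℝ)
    filter_upwards [eventually_lt_of_lt_liminf (hneg.trans_le hcon), eventually_gt_atTop 0]
      with x hx hx0
    have hx' : -1 < mertensK K x / x ^ (Θ - ε) := by exact_mod_cast hx
    rw [lt_div_iff₀ (Real.rpow_pos_of_pos hx0 _)] at hx'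
    linarith
  · obtain ⟨θ, hθ, hθΘ⟩ := exists_between (max_lt hnoRH hlt)
    refine not_eventually_mul_mertensK_le_of_isLUB hZ hΘ hΘ' 2 one_ne_zero
      ((le_max_right _ _).trans_lt hθ) hθΘ ?_
    have h12 : (1 : EReal) < ((2 : ℝ) : EReal) := by exact_mod_cast one_lt_two (α := ℝ)
    filter_upwards [eventually_lt_of_limsup_lt (hconj.2.2.trans_lt h12), eventually_ge_atTop 1]
      with x hx hx1
    have hx' : mertensK K x / Real.sqrt x < 2 := by exact_mod_cast hx
    rw [div_lt_iff₀ (Real.sqrt_pos.2 (by linarith))] at hx'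
    have hle : Real.sqrt x ≤ x ^ θ := by
      rw [Real.sqrt_eq_rpow]
      exact Real.rpow_le_rpow_of_exponent_le hx1 ((le_max_left _ _).trans hθ.le)
    linarith
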